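/- For every v in the set M = {136, 139, 277, 280, 283, 292, 295, 298, 301, 409, 412, 415, 424, 427, 430, 433, 436, 439, 442, 445, 448, 454, 457, 460, 463, 478, 481, 496, 499, 553} there exists a super-simple 2-(v,4,2) directed design whose every defining set contains at least half of the total number of blocks. -/

import Mathlib

/-- A `t-(v,k,λ)` directed design on the point type `X`: a collection of
blocks, each an ordered `k`-tuple (a duplicate-free list of length `k`) of
points, such that every ordered `t`-tuple of distinct points occurs, in the
given order (i.e. as a sublist), in exactly `lam` blocks. -/
structure DirectedDesign (X : Type*) [DecidableEq X] (t k lam : ℕ) where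
  blocks : Multiset (List X)
  len : ∀ b ∈ blocks, b.length = k
  nodup : ∀ b ∈ blocks, b.Nodup
  covers : ∀ s : List X, s.length = t → s.Nodup →
    blocks.countP (fun b => s.Sublist b) = lam

/-- A directed design is super-simple if it has no repeated blocks and any two
distinct blocks have at most 2 points in common. -/
def DirectedDesign.SuperSimple {X : Type*} [DecidableEq X] {t k lam : ℕ}
    (D : DirectedDesign X t k lam) : Prop :=
  D.blocks.Nodup ∧
    ∀ b₁ ∈ D.blocks, ∀ b₂ ∈ D.blocks, b₁ ≠ b₂ →
      (b₁.toFinset ∩ b₂.toFinset).card ≤ 2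

/-- `S` is a defining set of the directed design `D` if `S` is a
subcollection of the blocks of `D` and `D.blocks` is the unique block
collection of a `t-(v,k,λ)` directed design on the same point set
containing `S`. -/
def DirectedDesign.IsDefiningSet {X : Type*} [DecidableEq X] {t k lam : ℕ}
    (D : DirectedDesign X t k lam) (S : Multiset (List X)) : Prop :=
  S ≤ D.blocks ∧
    ∀ D' : DirectedDesign X t k lam, S ≤ D'.blocks → D'.blocks = D.blocks

/-- Every defining set of `D` contains at least half of the blocks
(the paper's condition `d ≥ 1/2`). -/
def DirectedDesign.DefiningHalf {X : Type*} [DecidableEq X] {t k lam : ℕ}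
    (D : DirectedDesign X t k lam) : Prop :=
  ∀ S : Multiset (List X), D.IsDefiningSet S →
    Multiset.card D.blocks ≤ 2 * Multiset.card S

/-- A `(v,k,t)` directed trade `T = T₁ - T₂`: two disjoint nonempty
collections of blocks of the same volume such that every ordered `t`-tuple
of distinct points is covered by equally many blocks of `T₁` as of `T₂`. -/
structure DirectedTrade (X : Type*) [DecidableEq X] (k t : ℕ) where
  pos : Multiset (List X)
  neg : Multiset (List X)
  pos_len : ∀ b ∈ pos, b.length = k
  pos_nodup : ∀ b ∈ pos, b.Nodup
  neg_len : ∀ b ∈ neg, b.length = k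
  neg_nodup : ∀ b ∈ neg, b.Nodup
  disjoint : Disjoint pos neg
  pos_ne : pos ≠ 0
  card_eq : Multiset.card pos = Multiset.card neg
  balanced : ∀ s : List X, s.length = t → s.Nodup →
    pos.countP (fun b => s.Sublist b) = neg.countP (fun b => s.Sublist b)

/-- A `(k,λ)` directed group divisible design (DGDD) with the given group set
`groups`: blocks are ordered `k`-tuples of distinct points meeting each group
in at most one point, and every ordered pair of distinct points from
different groups occurs, in order, in exactly `lam` blocks. -/
structure DGDD (X : Type*) [DecidableEq X] (groups : Finset (Finset X))
    (k lam : ℕ) where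
  blocks : Multiset (List X)
  len : ∀ b ∈ blocks, b.length = k
  nodup : ∀ b ∈ blocks, b.Nodup
  transverse : ∀ b ∈ blocks, ∀ G ∈ groups, (b.toFinset ∩ G).card ≤ 1
  covers : ∀ x y : X, x ≠ y → (∀ G ∈ groups, ¬(x ∈ G ∧ y ∈ G)) →
    blocks.countP (fun b => [x, y].Sublist b) = lam

/-- A DGDD is super-simple if it has no repeated blocks and any two distinct
blocks have at most 2 points in common. -/
def DGDD.SuperSimple {X : Type*} [DecidableEq X] {groups : Finset (Finset X)}
    {k lam : ℕ} (D : DGDD X groups k lam) : Prop :=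
  D.blocks.Nodup ∧
    ∀ b₁ ∈ D.blocks, ∀ b₂ ∈ D.blocks, b₁ ≠ b₂ →
      (b₁.toFinset ∩ b₂.toFinset).card ≤ 2

/-- `S` is a defining set of the DGDD `D` if `S` is a subcollection of the
blocks of `D` and `D.blocks` is the unique block collection of a
`(k,λ)`-DGDD with the same groups containing `S`. -/
def DGDD.IsDefiningSet {X : Type*} [DecidableEq X] {groups : Finset (Finset X)}
    {k lam : ℕ} (D : DGDD X groups k lam) (S : Multiset (List X)) : Prop :=
  S ≤ D.blocks ∧
    ∀ D' : DGDD X groups k lam, S ≤ D'.blocks → D'.blocks = D.blocks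

/-- Every defining set of the DGDD `D` contains at least half of the blocks. -/
def DGDD.DefiningHalf {X : Type*} [DecidableEq X] {groups : Finset (Finset X)}
    {k lam : ℕ} (D : DGDD X groups k lam) : Prop :=
  ∀ S : Multiset (List X), D.IsDefiningSet S →
    Multiset.card D.blocks ≤ 2 * Multiset.card S

/-- A (undirected) `(K,λ)` group divisible design with the given group set
`groups`: blocks are subsets of the point set with sizes in `K` meeting each
group in at most one point, and every pair of distinct points from different
groups lies in exactly `lam` blocks. -/
structure GDD (X : Type*) [DecidableEq X] (groups : Finset (Finset X))
    (K : Finset ℕ) (lam : ℕ) where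
  blocks : Multiset (Finset X)
  size_mem : ∀ b ∈ blocks, b.card ∈ K
  transverse : ∀ b ∈ blocks, ∀ G ∈ groups, (b ∩ G).card ≤ 1
  covers : ∀ x y : X, x ≠ y → (∀ G ∈ groups, ¬(x ∈ G ∧ y ∈ G)) →
    blocks.countP (fun b => x ∈ b ∧ y ∈ b) = lam

/-- `groups` is a partition of the point type `X`: every point lies in
exactly one group. -/
def IsGroupPartition {X : Type*} (groups : Finset (Finset X)) : Prop :=
  ∀ x : X, ∃! G, G ∈ groups ∧ x ∈ G

namespace CyclicDD

set_option linter.unusedSectionVars false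

/-! ### Abstract part: designs developed from base blocks over an abelian group -/

section abstract_part

variable {G ι : Type*} [AddCommGroup G] [DecidableEq G] [Fintype G] [Fintype ι] [DecidableEq ι]

/-- The translate by `s` of a base block. -/
def blk (q : G × G × G × G) (s : G) : List G :=
  [q.1 + s, q.2.1 + s, q.2.2.1 + s, q.2.2.2 + s]

/-- The six ordered differences of a base block. -/
def dl (q : G × G × G × G) : List G :=
  [q.2.1 - q.1, q.2.2.1 - q.1, q.2.2.2 - q.1, q.2.2.1 - q.2.1, q.2.2.2 - q.2.1,
    q.2.2.2 - q.2.2.1]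

/-- The three triples with a given apex `a`, and the other points `b, c, d`. -/
def apex (a b c d : G) : List (Sym2 G) :=
  [s(b - a, c - a), s(b - a, d - a), s(c - a, d - a)]

/-- All pointed triples of a base block. -/
def al (q : G × G × G × G) : List (Sym2 G) :=
  apex q.1 q.2.1 q.2.2.1 q.2.2.2 ++ (apex q.2.1 q.1 q.2.2.1 q.2.2.2 ++
    (apex q.2.2.1 q.1 q.2.1 q.2.2.2 ++ apex q.2.2.2 q.1 q.2.1 q.2.2.1))

/-- All the blocks. -/
def allBlocks (x : ι → G × G × G × G) : Multiset (List G) :=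
  (Finset.univ : Finset (ι × G)).val.map (fun α => blk (x α.1) α.2)

theorem pair_sublist {X : Type*} (x y a b c d : X) :
    [x, y].Sublist [a, b, c, d] ↔
      (x = a ∧ (y = b ∨ y = c ∨ y = d)) ∨ (x = b ∧ (y = c ∨ y = d)) ∨ (x = c ∧ y = d) := by
  simp only [List.sublist_cons_iff, List.cons.injEq]
  constructor
  · intro h
    simp at h
    aesop
  · intro h
    simp
    aesop

theorem blk_nodup {q : G × G × G × G} (h : (0 : G) ∉ dl q) (s : G) : (blk q s).Nodup := by
  obtain ⟨a, b, c, d⟩ := q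
  simp only [dl, List.mem_cons, List.not_mem_nil, or_false, not_or] at h
  simp only [blk, List.nodup_cons, List.mem_cons, List.not_mem_nil, or_false, not_or,
    add_left_inj, not_false_eq_true, List.nodup_nil, and_true]
  obtain ⟨h1, h2, h3, h4, h5, h6⟩ := h
  refine ⟨⟨?_, ?_, ?_⟩, ⟨?_, ?_⟩, ?_⟩ <;> rintro rfl <;> simp_all

theorem sum_ind (a b x y : G) :
    (∑ s : G, if x = a + s ∧ y = b + s then 1 else 0) = if b - a = y - x then 1 else 0 := by
  by_cases h : b - a = y - x
  · rw [if_pos h, Finset.sum_eq_single (x - a)]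
    · rw [if_pos]
      refine ⟨by abel, ?_⟩
      have : y = b - a + x := by rw [h]; abel
      rw [this]; abel
    · intro s _ hs
      rw [if_neg]
      rintro ⟨h1, _⟩
      exact hs (by rw [h1]; abel)
    · simp
  · rw [if_neg h]
    apply Finset.sum_eq_zero
    intro s _
    rw [if_neg]
    rintro ⟨rfl, rfl⟩
    exact h (by abel)

theorem cover_one {q : G × G × G × G} (h : (0 : G) ∉ dl q) (x y : G) :
    (∑ s : G, if [x, y].Sublist (blk q s) then 1 else 0) = (dl q).count (y - x) := by
  have key : ∀ s : G, (if [x, y].Sublist (blk q s) then 1 else 0) =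
      (if x = q.1 + s ∧ y = q.2.1 + s then 1 else 0)
      + (if x = q.1 + s ∧ y = q.2.2.1 + s then 1 else 0)
      + (if x = q.1 + s ∧ y = q.2.2.2 + s then 1 else 0)
      + (if x = q.2.1 + s ∧ y = q.2.2.1 + s then 1 else 0)
      + (if x = q.2.1 + s ∧ y = q.2.2.2 + s then 1 else 0)
      + (if x = q.2.2.1 + s ∧ y = q.2.2.2 + s then 1 else 0) := by
    intro s
    have hn := blk_nodup h s
    rw [blk] at hn ⊢
    simp only [pair_sublist]
    generalize q.1 + s = a at *
    generalize q.2.1 + s = b at *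
    generalize q.2.2.1 + s = c at *
    generalize q.2.2.2 + s = d at *
    simp only [List.nodup_cons, List.mem_cons, List.not_mem_nil, or_false, not_or] at hn
    obtain ⟨⟨h1, h2, h3⟩, ⟨h4, h5⟩, h6, _⟩ := hn
    by_cases e1 : x = a
    · subst e1
      by_cases f1 : y = b
      · subst f1; simp [*, Ne.symm]
      · by_cases f2 : y = c
        · subst f2; simp [*, Ne.symm]
        · simp [*, Ne.symm]
    · by_cases e2 : x = b
      · subst e2
        by_cases f2 : y = c
        · subst f2; simp [*, Ne.symm]
        · simp [*, Ne.symm]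
      · simp [*]
  simp only [key, Finset.sum_add_distrib, sum_ind]
  simp only [dl, List.count_cons, List.count_nil, beq_iff_eq]
  ring

theorem countP_allBlocks (x : ι → G × G × G × G) (p : List G → Prop) [DecidablePred p] :
    (allBlocks x).countP p = ∑ i, ∑ s, if p (blk (x i) s) then 1 else 0 := by
  rw [allBlocks, Multiset.countP_map, ← Fintype.sum_prod_type', ← Finset.card_filter]
  rfl

/-- Membership of three distinct points in a translate. -/
theorem mem_apex {a b c d s p q r : G} (hp : p = a + s) (hpq : p ≠ q) (hpr : p ≠ r) (hqr : q ≠ r)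
    (hq : q ∈ [a + s, b + s, c + s, d + s]) (hr : r ∈ [a + s, b + s, c + s, d + s]) :
    s(q - p, r - p) ∈ apex a b c d := by
  simp only [List.mem_cons, List.not_mem_nil, or_false] at hq hr
  subst hp
  rcases hq with rfl | rfl | rfl | rfl <;> rcases hr with rfl | rfl | rfl | rfl <;>
    simp_all [apex, Sym2.eq_swap]

/-- The apex lists indexed by `Fin 4`. -/
def apx (q : G × G × G × G) : Fin 4 → List (Sym2 G)
  | 0 => apex q.1 q.2.1 q.2.2.1 q.2.2.2
  | 1 => apex q.2.1 q.1 q.2.2.1 q.2.2.2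
  | 2 => apex q.2.2.1 q.1 q.2.1 q.2.2.2
  | 3 => apex q.2.2.2 q.1 q.2.1 q.2.2.1

/-- The points of a base block indexed by `Fin 4`. -/
def pt (q : G × G × G × G) : Fin 4 → G
  | 0 => q.1
  | 1 => q.2.1
  | 2 => q.2.2.1
  | 3 => q.2.2.2

theorem count_al (q : G × G × G × G) (u : Sym2 G) :
    (al q).count u = ∑ k, (apx q k).count u := by
  rw [Fin.sum_univ_four]
  simp only [al, apx, List.count_append]
  ring

theorem exists_apex {t : G × G × G × G} {s p q r : G} (hpq : p ≠ q) (hpr : p ≠ r) (hqr : q ≠ r)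
    (hp : p ∈ blk t s) (hq : q ∈ blk t s) (hr : r ∈ blk t s) :
    ∃ k, p = pt t k + s ∧ s(q - p, r - p) ∈ apx t k := by
  obtain ⟨a, b, c, d⟩ := t
  simp only [blk] at hp hq hr
  have hp' := hp
  simp only [List.mem_cons, List.not_mem_nil, or_false] at hp'
  rcases hp' with h | h | h | h
  · exact ⟨0, h, mem_apex h hpq hpr hqr hq hr⟩
  · refine ⟨1, h, mem_apex h hpq hpr hqr ?_ ?_⟩
    · simp only [List.mem_cons, List.not_mem_nil, or_false] at hq ⊢; tauto
    · simp only [List.mem_cons, List.not_mem_nil, or_false] at hr ⊢; tauto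
  · refine ⟨2, h, mem_apex h hpq hpr hqr ?_ ?_⟩
    · simp only [List.mem_cons, List.not_mem_nil, or_false] at hq ⊢; tauto
    · simp only [List.mem_cons, List.not_mem_nil, or_false] at hr ⊢; tauto
  · refine ⟨3, h, mem_apex h hpq hpr hqr ?_ ?_⟩
    · simp only [List.mem_cons, List.not_mem_nil, or_false] at hq ⊢; tauto
    · simp only [List.mem_cons, List.not_mem_nil, or_false] at hr ⊢; tauto

theorem three_common {x : ι → G × G × G × G}
    (H2 : ∀ u : Sym2 G, ∑ i, (al (x i)).count u ≤ 1)
    {α β : ι × G} {p q r : G} (hpq : p ≠ q) (hpr : p ≠ r) (hqr : q ≠ r)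
    (hp : p ∈ blk (x α.1) α.2) (hq : q ∈ blk (x α.1) α.2) (hr : r ∈ blk (x α.1) α.2)
    (hp' : p ∈ blk (x β.1) β.2) (hq' : q ∈ blk (x β.1) β.2) (hr' : r ∈ blk (x β.1) β.2) :
    α = β := by
  obtain ⟨k, hk, hk'⟩ := exists_apex hpq hpr hqr hp hq hr
  obtain ⟨l, hl, hl'⟩ := exists_apex hpq hpr hqr hp' hq' hr'
  have h := H2 s(q - p, r - p)
  simp only [count_al] at h
  rw [← Fintype.sum_prod_type' (f := fun i k => (apx (x i) k).count s(q - p, r - p))] at h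
  have heq : (α.1, k) = (β.1, l) := by
    by_contra hne
    have h2 : ∑ j ∈ ({(α.1, k), (β.1, l)} : Finset (ι × Fin 4)),
        (apx (x j.1) j.2).count s(q - p, r - p) ≤ 1 :=
      le_trans (Finset.sum_le_sum_of_subset (Finset.subset_univ _)) h
    rw [Finset.sum_pair hne] at h2
    have h3 := List.count_pos_iff.mpr hk'
    have h4 := List.count_pos_iff.mpr hl'
    simp only at h2
    omega
  simp only [Prod.mk.injEq] at heq
  obtain ⟨e1, rfl⟩ := heq
  refine Prod.ext e1 ?_
  rw [hk, e1] at hl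
  exact add_left_cancel hl

theorem trade_count {X : Type*} [DecidableEq X] (x y p q r s u w : X) (hxy : x ≠ y)
    (h1 : [p, q, r, s].Nodup) (h2 : [u, w, q, p].Nodup) :
    (if [x, y].Sublist [p, q, r, s] then 1 else 0) + (if [x, y].Sublist [u, w, q, p] then 1 else 0)
    = (if [x, y].Sublist [q, p, r, s] then 1 else 0)
      + (if [x, y].Sublist [u, w, p, q] then 1 else 0) := by
  simp only [pair_sublist]
  simp only [List.nodup_cons, List.mem_cons, List.not_mem_nil, or_false, not_or] at h1 h2
  obtain ⟨⟨a1, a2, a3⟩, ⟨a4, a5⟩, a6, _⟩ := h1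
  obtain ⟨⟨b1, b2, b3⟩, ⟨b4, b5⟩, b6, _⟩ := h2
  by_cases e1 : x = p
  · subst e1
    by_cases f1 : y = q
    · subst f1
      simp [*, Ne.symm, eq_comm]
      exact ⟨Ne.symm b3, Ne.symm b5⟩
    · simp [*, Ne.symm, eq_comm]
  · by_cases e2 : x = q
    · subst e2
      by_cases f1 : y = p
      · subst f1
        simp [*, Ne.symm, eq_comm]
        exact ⟨Ne.symm b2, Ne.symm b4⟩
      · simp [*, Ne.symm, eq_comm]
    · simp [*, or_comm]

/-- The directed design obtained from base blocks. -/
def mkDD (x : ι → G × G × G × G) (H0 : ∀ i, (0 : G) ∉ dl (x i))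
    (H1 : ∀ δ : G, δ ≠ 0 → ∑ i, (dl (x i)).count δ = 2) : DirectedDesign G 2 4 2 where
  blocks := allBlocks x
  len := by
    intro b hb
    simp only [allBlocks, Multiset.mem_map] at hb
    obtain ⟨α, _, rfl⟩ := hb
    rfl
  nodup := by
    intro b hb
    simp only [allBlocks, Multiset.mem_map] at hb
    obtain ⟨α, _, rfl⟩ := hb
    exact blk_nodup (H0 _) _
  covers := by
    intro s hs hn
    obtain ⟨y, z, rfl⟩ := List.length_eq_two.mp hs
    have hne : z - y ≠ 0 := by
      intro h
      have : y = z := (sub_eq_zero.mp h).symm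
      subst this
      simp at hn
    rw [countP_allBlocks, ← H1 _ hne]
    exact Finset.sum_congr rfl fun i _ => cover_one (H0 i) y z

theorem mkDD_superSimple (x : ι → G × G × G × G) (H0 : ∀ i, (0 : G) ∉ dl (x i))
    (H1 : ∀ δ : G, δ ≠ 0 → ∑ i, (dl (x i)).count δ = 2)
    (H2 : ∀ u : Sym2 G, ∑ i, (al (x i)).count u ≤ 1) :
    (mkDD x H0 H1).SuperSimple ∧
      Function.Injective (fun α : ι × G => blk (x α.1) α.2) := by
  have hinj : Function.Injective (fun α : ι × G => blk (x α.1) α.2) := by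
    intro α β h
    simp only at h
    have hn := blk_nodup (H0 α.1) α.2
    have m1 : (x α.1).1 + α.2 ∈ blk (x α.1) α.2 := by simp [blk]
    have m2 : (x α.1).2.1 + α.2 ∈ blk (x α.1) α.2 := by simp [blk]
    have m3 : (x α.1).2.2.1 + α.2 ∈ blk (x α.1) α.2 := by simp [blk]
    simp only [blk, List.nodup_cons, List.mem_cons, List.not_mem_nil, or_false, not_or] at hn
    obtain ⟨⟨a1, a2, a3⟩, ⟨a4, a5⟩, a6, _⟩ := hn
    exact three_common H2 a1 a2 a4 m1 m2 m3 (h ▸ m1) (h ▸ m2) (h ▸ m3)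
  refine ⟨⟨?_, ?_⟩, hinj⟩
  · exact (Multiset.nodup_map_iff_of_injective hinj).mpr Finset.univ.nodup
  · intro b₁ hb₁ b₂ hb₂ hne
    simp only [mkDD, allBlocks, Multiset.mem_map] at hb₁ hb₂
    obtain ⟨α, _, rfl⟩ := hb₁
    obtain ⟨β, _, rfl⟩ := hb₂
    by_contra hc
    push Not at hc
    obtain ⟨p, q, r, hp, hq, hr, hpq, hpr, hqr⟩ := Finset.two_lt_card_iff.mp hc
    simp only [Finset.mem_inter, List.mem_toFinset] at hp hq hr
    apply hne
    rw [three_common H2 hpq hpr hqr hp.1 hq.1 hr.1 hp.2 hq.2 hr.2]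

/-- If a subcollection misses both blocks of a trade of volume two, it is not defining. -/
theorem not_defining {X : Type*} [DecidableEq X] {D : DirectedDesign X 2 4 2}
    (hD : D.SuperSimple) {S : Multiset (List X)} (hS : D.IsDefiningSet S) {p q r s u w : X}
    (h1 : [p, q, r, s] ∈ D.blocks) (h2 : [u, w, q, p] ∈ D.blocks)
    (n1 : [p, q, r, s] ∉ S) (n2 : [u, w, q, p] ∉ S) : False := by
  have d1 := D.nodup _ h1
  have d2 := D.nodup _ h2
  have hne : [p, q, r, s] ≠ [u, w, q, p] := by
    intro h
    simp only [List.cons.injEq, and_true] at h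
    obtain ⟨rfl, rfl, rfl, rfl⟩ := h
    simp at d1
  obtain ⟨R', hR'⟩ := Multiset.exists_cons_of_mem h1
  have h2' : [u, w, q, p] ∈ R' := by
    rw [hR', Multiset.mem_cons] at h2
    exact h2.resolve_left (Ne.symm hne)
  obtain ⟨R, rfl⟩ := Multiset.exists_cons_of_mem h2'
  have hSnd : S.Nodup := Multiset.nodup_of_le hS.1 hD.1
  have hSR : S ≤ R := by
    rw [Multiset.le_iff_subset hSnd]
    intro b hb
    have hb' := Multiset.mem_of_le hS.1 hb
    rw [hR', Multiset.mem_cons, Multiset.mem_cons] at hb'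
    rcases hb' with rfl | rfl | h
    · exact absurd hb n1
    · exact absurd hb n2
    · exact h
  have hmem : ∀ b ∈ R, b ∈ D.blocks := by
    intro b hb
    rw [hR']
    simp [hb]
  let D' : DirectedDesign X 2 4 2 :=
    { blocks := [q, p, r, s] ::ₘ [u, w, p, q] ::ₘ R
      len := by
        intro b hb
        rw [Multiset.mem_cons, Multiset.mem_cons] at hb
        rcases hb with rfl | rfl | h
        · rfl
        · rfl
        · exact D.len _ (hmem _ h)
      nodup := by
        intro b hb
        rw [Multiset.mem_cons, Multiset.mem_cons] at hb
        rcases hb with rfl | rfl | h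
        · exact (List.Perm.swap q p [r, s]).nodup_iff.mp d1
        · exact (((List.Perm.swap p q []).cons w).cons u).nodup_iff.mp d2
        · exact D.nodup _ (hmem _ h)
      covers := by
        intro t ht hn
        obtain ⟨y, z, rfl⟩ := List.length_eq_two.mp ht
        have hyz : y ≠ z := by
          intro h
          subst h
          simp at hn
        rw [← D.covers _ ht hn, hR']
        simp only [Multiset.countP_cons]
        have := trade_count y z p q r s u w hyz d1 d2
        omega }
  have hD' := hS.2 D' (hSR.trans ((Multiset.le_cons_self _ _).trans (Multiset.le_cons_self _ _)))
  have hm : [q, p, r, s] ∈ D.blocks := by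
    rw [← hD']
    exact Multiset.mem_cons_self _ _
  have hne2 : [p, q, r, s] ≠ [q, p, r, s] := by
    intro h
    simp only [List.cons.injEq] at h
    obtain ⟨rfl, _⟩ := h
    simp at d1
  have hc := hD.2 _ h1 _ hm hne2
  have he : ([q, p, r, s] : List X).toFinset = [p, q, r, s].toFinset :=
    List.toFinset_eq_of_perm _ _ (List.Perm.swap p q [r, s])
  rw [he, Finset.inter_self, List.toFinset_card_of_nodup d1] at hc
  simp at hc

/-- Two blocks form a trade of volume two. -/
def IsTrade {X : Type*} (b b' : List X) : Prop :=
  ∃ p q r s u w, b = [p, q, r, s] ∧ b' = [u, w, q, p]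

theorem mkDD_half (x : ι → G × G × G × G) (H0 : ∀ i, (0 : G) ∉ dl (x i))
    (H1 : ∀ δ : G, δ ≠ 0 → ∑ i, (dl (x i)).count δ = 2)
    (H2 : ∀ u : Sym2 G, ∑ i, (al (x i)).count u ≤ 1)
    (φ : ι × G → ι × G) (hφ : Function.Injective φ)
    (H3 : ∀ α, IsTrade (blk (x α.1) α.2) (blk (x (φ α).1) (φ α).2) ∨
      IsTrade (blk (x (φ α).1) (φ α).2) (blk (x α.1) α.2)) :
    ∃ D : DirectedDesign G 2 4 2, D.SuperSimple ∧ D.DefiningHalf := by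
  obtain ⟨hss, hinj⟩ := mkDD_superSimple x H0 H1 H2
  refine ⟨mkDD x H0 H1, hss, ?_⟩
  intro S hS
  classical
  have hmem : ∀ α : ι × G, blk (x α.1) α.2 ∈ (mkDD x H0 H1).blocks := fun α =>
    Multiset.mem_map_of_mem (fun α : ι × G => blk (x α.1) α.2) (Finset.mem_univ α)
  have hcov : ∀ α : ι × G, blk (x α.1) α.2 ∈ S ∨ blk (x (φ α).1) (φ α).2 ∈ S := by
    intro α
    by_contra hc
    push Not at hc
    have m1 := hmem α
    have m2 := hmem (φ α)
    rcases H3 α with ⟨p, q, r, s, u, w, e1, e2⟩ | ⟨p, q, r, s, u, w, e1, e2⟩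
    · rw [e1] at hc m1
      rw [e2] at hc m2
      exact not_defining hss hS m1 m2 hc.1 hc.2
    · rw [e2] at hc m1
      rw [e1] at hc m2
      exact not_defining hss hS m2 m1 hc.2 hc.1
  set T : Finset (ι × G) := Finset.univ.filter (fun α => blk (x α.1) α.2 ∈ S) with hT
  have hTS : T.card ≤ Multiset.card S := by
    rw [← Finset.card_image_of_injective T hinj]
    refine le_trans (Finset.card_le_card (t := S.toFinset) ?_) (Multiset.toFinset_card_le S)
    intro b hb
    simp only [Finset.mem_image, hT, Finset.mem_filter] at hb
    obtain ⟨α, ⟨_, h⟩, rfl⟩ := hb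
    exact Multiset.mem_toFinset.mpr h
  have hT2 : (Finset.univ.filter (fun α => φ α ∈ T)).card ≤ T.card :=
    Finset.card_le_card_of_injOn φ (by intro α hα; simpa using hα) hφ.injOn
  have hU : (Finset.univ : Finset (ι × G)) ⊆ T ∪ Finset.univ.filter (fun α => φ α ∈ T) := by
    intro α _
    rcases hcov α with h | h
    · exact Finset.mem_union_left _ (by simpa [hT] using h)
    · exact Finset.mem_union_right _ (by simpa [hT] using h)
  have hc1 := (Finset.card_le_card hU).trans (Finset.card_union_le _ _)
  have hc2 : Multiset.card (mkDD x H0 H1).blocks = (Finset.univ : Finset (ι × G)).card := by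
    simp only [mkDD, allBlocks, Multiset.card_map]
    rfl
  omega

end abstract_part

/-! ### Concrete part: certificates over the integers modulo `v` -/

/-- Evaluate `n` before passing it on. -/
def force {α : Type} (n : ℕ) (f : ℕ → α) : α :=
  match n with
  | 0 => f 0
  | k + 1 => f (k + 1)

theorem force_eq {α : Type} (n : ℕ) (f : ℕ → α) : force n f = f n := by
  cases n <;> rfl

/-- Checks that the list together with the mask has no repeated entry. -/
def check1 : List ℕ → ℕ → Bool
  | [], _ => true
  | a :: l, m => force a fun a =>
      match m.testBit a with
      | true => false
      | false => force (m ||| 1 <<< a) fun m' => check1 l m'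

/-- Checks that no entry occurs more than twice. -/
def check2 : List ℕ → ℕ → ℕ → Bool
  | [], _, _ => true
  | a :: l, m, k => force a fun a =>
      match m.testBit a with
      | false => force (m ||| 1 <<< a) fun m' => check2 l m' k
      | true =>
        match k.testBit a with
        | true => false
        | false => force (k ||| 1 <<< a) fun k' => check2 l m k'

/-- Splits a list according to parity, halving the entries. -/
def split : List ℕ → List ℕ → List ℕ → (List ℕ → List ℕ → Bool) → Bool
  | [], e, o, f => f e o
  | a :: l, e, o, f => force a fun a => force (Nat.div a 2) fun h =>
      match Nat.beq (Nat.mod a 2) 0 with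
      | true => split l (h :: e) o f
      | false => split l e (h :: o) f

/-- Checks that a list has no repeated entry, after `k` rounds of splitting. -/
def checkR : ℕ → List ℕ → Bool
  | 0, l => check1 l 0
  | k + 1, l => split l [] [] fun e o => checkR k e && checkR k o

theorem split_spec (l e o : List ℕ) (f : List ℕ → List ℕ → Bool) :
    ∃ e' o', split l e o f = f e' o' ∧ (∀ x, e'.count x = e.count x + l.count (2 * x)) ∧
      ∀ x, o'.count x = o.count x + l.count (2 * x + 1) := by
  induction l generalizing e o with
  | nil => exact ⟨e, o, rfl, by simp, by simp⟩
  | cons a l ih =>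
    rw [split, force_eq, force_eq]
    have hd : Nat.div a 2 = a / 2 := rfl
    split
    · rename_i h
      have h' : a % 2 = 0 := Nat.eq_of_beq_eq_true h
      obtain ⟨e', o', h1, h2, h3⟩ := ih (Nat.div a 2 :: e) o
      refine ⟨e', o', h1, ?_, ?_⟩
      · intro x
        rw [h2, List.count_cons, List.count_cons, hd]
        have : (a / 2 == x) = (a == 2 * x) := by
          rw [Bool.eq_iff_iff, beq_iff_eq, beq_iff_eq]
          omega
        rw [this]
        ring
      · intro x
        have : (a == 2 * x + 1) = false := by
          rw [beq_eq_false_iff_ne]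
          omega
        rw [h3, List.count_cons, this]
        simp
    · rename_i h
      have h' : a % 2 ≠ 0 := Nat.ne_of_beq_eq_false h
      obtain ⟨e', o', h1, h2, h3⟩ := ih e (Nat.div a 2 :: o)
      refine ⟨e', o', h1, ?_, ?_⟩
      · intro x
        have : (a == 2 * x) = false := by
          rw [beq_eq_false_iff_ne]
          omega
        rw [h2, List.count_cons, this]
        simp
      · intro x
        rw [h3, List.count_cons, List.count_cons, hd]
        have : (a / 2 == x) = (a == 2 * x + 1) := by
          rw [Bool.eq_iff_iff, beq_iff_eq, beq_iff_eq]
          omega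
        rw [this]
        ring

theorem testBit_or (m a x : ℕ) : (m ||| 1 <<< a).testBit x = (m.testBit x || decide (a = x)) := by
  rw [Nat.testBit_or, Nat.one_shiftLeft, Nat.testBit_two_pow]

theorem check1_spec (l : List ℕ) (m x : ℕ) (h : check1 l m = true) :
    l.count x + (m.testBit x).toNat ≤ 1 := by
  induction l generalizing m with
  | nil => simpa using Bool.toNat_le _
  | cons a l ih =>
    rw [check1, force_eq] at h
    split at h
    · simp at h
    · rename_i hm
      rw [force_eq] at h
      have := ih _ h
      rw [testBit_or] at this
      by_cases hx : a = x
      · subst hx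
        simp [hm] at this ⊢
        omega
      · simpa [hx, List.count_cons] using this

theorem checkR_spec (k : ℕ) (l : List ℕ) (x : ℕ) (h : checkR k l = true) : l.count x ≤ 1 := by
  induction k generalizing l x with
  | zero => exact le_trans (Nat.le_add_right _ _) (check1_spec l 0 x h)
  | succ k ih =>
    rw [checkR] at h
    obtain ⟨e', o', h1, h2, h3⟩ := split_spec l [] [] fun e o => checkR k e && checkR k o
    rw [h1, Bool.and_eq_true] at h
    rcases Nat.even_or_odd' x with ⟨c, rfl | rfl⟩
    · have := ih e' c h.1
      rw [h2] at this
      simpa using this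
    · have := ih o' c h.2
      rw [h3] at this
      simpa using this

theorem check2_spec (l : List ℕ) (m k x : ℕ) (h : check2 l m k = true) :
    l.count x + (m.testBit x).toNat + (k.testBit x).toNat ≤ 2 := by
  induction l generalizing m k with
  | nil =>
    have h1 := Bool.toNat_le (m.testBit x)
    have h2 := Bool.toNat_le (k.testBit x)
    simp only [List.count_nil]
    omega
  | cons a l ih =>
    rw [check2, force_eq] at h
    split at h
    · rename_i hm
      rw [force_eq] at h
      have := ih _ _ h
      rw [testBit_or] at this
      by_cases hx : a = x
      · subst hx
        simp [hm] at this ⊢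
        omega
      · simpa [hx, List.count_cons] using this
    · rename_i hm
      split at h
      · simp at h
      · rename_i hk
        rw [force_eq] at h
        have := ih _ _ h
        rw [testBit_or] at this
        by_cases hx : a = x
        · subst hx
          simp [hm, hk] at this ⊢
          omega
        · simpa [hx, List.count_cons] using this

theorem count_eq_two {v : ℕ} {l : List ℕ} (hl : ∀ a ∈ l, a < v)
    (hlen : l.length = 2 * (v - 1)) (h : check2 l 1 1 = true) {x : ℕ} (h0 : 0 < x) (hx : x < v) :
    l.count x = 2 := by
  have hle : ∀ a ∈ Finset.Ico 1 v, l.count a ≤ 2 := by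
    intro a _
    have := check2_spec l 1 1 a h
    omega
  have hsum : ∑ a ∈ Finset.Ico 1 v, l.count a = ∑ a ∈ Finset.Ico 1 v, 2 := by
    have h1 : ∑ a ∈ Finset.Ico 1 v, (l : Multiset ℕ).count a = Multiset.card (l : Multiset ℕ) :=
      Multiset.sum_count_eq_card (by
        intro a ha
        have := hl a (by simpa using ha)
        have h0 := check2_spec l 1 1 0 h
        have h1 : 0 < a := by
          rcases Nat.eq_zero_or_pos a with rfl | h'
          · have := List.count_pos_iff.mpr (show 0 ∈ l by simpa using ha)
            simp at h0
            omega
          · exact h'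
        rw [Finset.mem_Ico]
        omega)
    simp only [Multiset.coe_count, Multiset.coe_card] at h1
    rw [h1, hlen]
    simp
    ring
  exact (Finset.sum_eq_sum_iff_of_le hle).mp hsum x (Finset.mem_Ico.mpr ⟨h0, hx⟩)

/-- The difference `b - a` modulo `v`. -/
def dN (v a b : ℕ) : ℕ :=
  Nat.mod (Nat.add (Nat.sub v (Nat.mod a v)) (Nat.mod b v)) v

/-- Differences of a base block given by natural numbers. -/
def dlN (v : ℕ) (q : ℕ × ℕ × ℕ × ℕ) : List ℕ :=
  match q with
  | (a, b, c, d) => [dN v a b, dN v a c, dN v a d, dN v b c, dN v b d, dN v c d]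

/-- The code of an unordered pair. -/
def codeN (v x y : ℕ) : ℕ :=
  match Nat.ble x y with
  | true => Nat.add (Nat.mul x v) y
  | false => Nat.add (Nat.mul y v) x

/-- The codes of the triples with apex `a`. -/
def apexN (v a b c d : ℕ) : List ℕ :=
  force (dN v a b) fun x => force (dN v a c) fun y => force (dN v a d) fun z =>
    [codeN v x y, codeN v x z, codeN v y z]

/-- The codes of all triples of a base block. -/
def alN (v : ℕ) (q : ℕ × ℕ × ℕ × ℕ) : List ℕ :=
  match q with
  | (a, b, c, d) => apexN v a b c d ++ (apexN v b a c d ++ (apexN v c a b d ++ apexN v d a b c))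

/-- The base blocks of a unit: either one self-paired block, or a pair of blocks. -/
def fstBlk (u : ℕ × ℕ × ℕ × ℕ × ℕ) : ℕ × ℕ × ℕ × ℕ := (0, u.1, u.2.1, u.2.2.1)

/-- The second block of a pair. -/
def sndBlk (u : ℕ × ℕ × ℕ × ℕ × ℕ) : ℕ × ℕ × ℕ × ℕ := (u.2.2.2.1, u.2.2.2.2, u.1, 0)

/-- The self-paired block. -/
def paraBlk (u : ℕ × ℕ) : ℕ × ℕ × ℕ × ℕ := (0, u.1, u.1 + u.2, u.2)

/-- All base blocks. -/
def baseN (P : List (ℕ × ℕ × ℕ × ℕ × ℕ)) (Q : List (ℕ × ℕ)) : List (ℕ × ℕ × ℕ × ℕ) :=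
  P.map fstBlk ++ (P.map sndBlk ++ Q.map paraBlk)

/-- The complete check of a certificate. -/
def certOK (v : ℕ) (P : List (ℕ × ℕ × ℕ × ℕ × ℕ)) (Q : List (ℕ × ℕ)) : Bool :=
  Nat.beq ((baseN P Q).flatMap (dlN v)).length (2 * (v - 1)) &&
  (check2 ((baseN P Q).flatMap (dlN v)) 1 1 &&
  checkR 6 ((baseN P Q).flatMap (alN v)))

section concrete

variable {v : ℕ} [NeZero v]

/-- A base block with entries in `Fin v`. -/
def toF (v : ℕ) [NeZero v] (q : ℕ × ℕ × ℕ × ℕ) : Fin v × Fin v × Fin v × Fin v :=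
  (Fin.ofNat v q.1, Fin.ofNat v q.2.1, Fin.ofNat v q.2.2.1, Fin.ofNat v q.2.2.2)

theorem val_sub (a b : ℕ) : (Fin.ofNat v b - Fin.ofNat v a).val = dN v a b := rfl

theorem dlN_eq (q : ℕ × ℕ × ℕ × ℕ) : dlN v q = (dl (toF v q)).map Fin.val := rfl

/-- The code of an unordered pair of elements of `Fin v`. -/
def code (u : Sym2 (Fin v)) : ℕ := (u.map Fin.val).inf * v + (u.map Fin.val).sup

theorem codeN_eq (x y : Fin v) : codeN v x.val y.val = code s(x, y) := by
  rw [codeN, code, Sym2.map_mk, Sym2.inf_mk, Sym2.sup_mk]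
  split
  · rename_i h
    have h := Nat.le_of_ble_eq_true h
    rw [inf_eq_left.mpr h, sup_eq_right.mpr h]
    rfl
  · rename_i h
    have h : y.val ≤ x.val := by
      by_contra hc
      rw [Nat.ble_eq_true_of_le (by omega)] at h
      simp at h
    rw [inf_eq_right.mpr h, sup_eq_left.mpr h]
    rfl

theorem alN_eq (q : ℕ × ℕ × ℕ × ℕ) : alN v q = (al (toF v q)).map code := by
  simp only [alN, apexN, force_eq, al, apex, toF, List.map_append, List.map_cons, List.map_nil,
    ← val_sub, codeN_eq]

theorem code_inj : Function.Injective (code : Sym2 (Fin v) → ℕ) := by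
  have key : ∀ a b c d : ℕ, b < v → d < v → a * v + b = c * v + d → a = c ∧ b = d := by
    intro a b c d hb hd h
    have hv : 0 < v := by omega
    have h1 : (a * v + b) / v = a := by
      rw [mul_comm, Nat.mul_add_div hv, Nat.div_eq_of_lt hb, add_zero]
    have h2 : (c * v + d) / v = c := by
      rw [mul_comm, Nat.mul_add_div hv, Nat.div_eq_of_lt hd, add_zero]
    have h3 : a = c := by rw [← h1, ← h2, h]
    subst h3
    exact ⟨rfl, by simpa using h⟩
  intro u w
  induction u using Sym2.ind with
  | _ a b =>
    induction w using Sym2.ind with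
    | _ c d =>
      intro h
      rw [code, code, Sym2.map_mk, Sym2.inf_mk, Sym2.sup_mk, Sym2.map_mk, Sym2.inf_mk,
        Sym2.sup_mk] at h
      have ha := a.isLt
      have hb := b.isLt
      have hc := c.isLt
      have hd := d.isLt
      obtain ⟨h1, h2⟩ := key _ _ _ _ (sup_lt_iff.mpr ⟨ha, hb⟩) (sup_lt_iff.mpr ⟨hc, hd⟩) h
      rw [Sym2.eq_iff]
      simp only [Fin.ext_iff]
      omega

/-- The base blocks as an indexed family. -/
def fam (v : ℕ) [NeZero v] (P : List (ℕ × ℕ × ℕ × ℕ × ℕ)) (Q : List (ℕ × ℕ)) :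
    (Fin P.length × Bool) ⊕ Fin Q.length → Fin v × Fin v × Fin v × Fin v
  | Sum.inl (i, false) => toF v (fstBlk P[i])
  | Sum.inl (i, true) => toF v (sndBlk P[i])
  | Sum.inr j => toF v (paraBlk Q[j])

theorem sum_fam (P : List (ℕ × ℕ × ℕ × ℕ × ℕ)) (Q : List (ℕ × ℕ))
    (g : Fin v × Fin v × Fin v × Fin v → ℕ) :
    ∑ i, g (fam v P Q i) = ((baseN P Q).map fun q => g (toF v q)).sum := by
  rw [Fintype.sum_sum_type, Fintype.sum_prod_type]
  simp only [Fintype.sum_bool, fam, Finset.sum_add_distrib, baseN, List.map_append,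
    List.sum_append, List.map_map]
  have e1 := Fin.sum_univ_fun_getElem P (fun u => g (toF v (fstBlk u)))
  have e2 := Fin.sum_univ_fun_getElem P (fun u => g (toF v (sndBlk u)))
  have e3 := Fin.sum_univ_fun_getElem Q (fun u => g (toF v (paraBlk u)))
  simp only [Fin.getElem_fin, Function.comp_def]
  rw [e1, e2, e3]
  ring

theorem fam_mem (P : List (ℕ × ℕ × ℕ × ℕ × ℕ)) (Q : List (ℕ × ℕ))
    (i : (Fin P.length × Bool) ⊕ Fin Q.length) :
    ∃ q ∈ baseN P Q, fam v P Q i = toF v q := by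
  simp only [baseN, List.mem_append, List.mem_map]
  rcases i with ⟨i, _ | _⟩ | j
  · exact ⟨fstBlk P[i], Or.inl ⟨_, List.getElem_mem _, rfl⟩, rfl⟩
  · exact ⟨sndBlk P[i], Or.inr (Or.inl ⟨_, List.getElem_mem _, rfl⟩), rfl⟩
  · exact ⟨paraBlk Q[j], Or.inr (Or.inr ⟨_, List.getElem_mem _, rfl⟩), rfl⟩

/-- The trade partner of a block. -/
def partner (v : ℕ) [NeZero v] (P : List (ℕ × ℕ × ℕ × ℕ × ℕ)) (Q : List (ℕ × ℕ)) :
    ((Fin P.length × Bool) ⊕ Fin Q.length) × Fin v →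
      ((Fin P.length × Bool) ⊕ Fin Q.length) × Fin v
  | (Sum.inl (i, b), s) => (Sum.inl (i, !b), s)
  | (Sum.inr j, s) => (Sum.inr j, s - Fin.ofNat v Q[j].2)

theorem partner_inj (P : List (ℕ × ℕ × ℕ × ℕ × ℕ)) (Q : List (ℕ × ℕ)) :
    Function.Injective (partner v P Q) := by
  rintro ⟨⟨i, b⟩ | j, s⟩ ⟨⟨i', b'⟩ | j', s'⟩ h
  · simpa [partner] using h
  · simp [partner] at h
  · simp [partner] at h
  · simp only [partner, Prod.mk.injEq, Sum.inr.injEq] at h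
    obtain ⟨rfl, h⟩ := h
    rw [sub_left_inj] at h
    rw [h]

theorem partner_trade (P : List (ℕ × ℕ × ℕ × ℕ × ℕ)) (Q : List (ℕ × ℕ))
    (α : ((Fin P.length × Bool) ⊕ Fin Q.length) × Fin v) :
    IsTrade (blk (fam v P Q α.1) α.2) (blk (fam v P Q (partner v P Q α).1) (partner v P Q α).2) ∨
    IsTrade (blk (fam v P Q (partner v P Q α).1) (partner v P Q α).2)
      (blk (fam v P Q α.1) α.2) := by
  obtain ⟨⟨i, _ | _⟩ | j, s⟩ := α
  · left
    exact ⟨_, _, _, _, _, _, rfl, rfl⟩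
  · right
    exact ⟨_, _, _, _, _, _, rfl, rfl⟩
  · left
    have e : Fin.ofNat v (Q[j].1 + Q[j].2) = Fin.ofNat v Q[j].1 + Fin.ofNat v Q[j].2 := by
      apply Fin.ext
      simp [Fin.val_add, Fin.ofNat]
    have e0 : Fin.ofNat v 0 = 0 := by
      apply Fin.ext
      simp [Fin.ofNat]
    simp only [blk, fam, partner, toF, paraBlk]
    rw [e, e0]
    generalize Fin.ofNat v Q[j].1 = d
    generalize Fin.ofNat v Q[j].2 = e
    refine ⟨0 + s, d + s, d + e + s, e + s, 0 + (s - e), d + (s - e), rfl, ?_⟩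
    have t1 : d + e + (s - e) = d + s := by abel
    have t2 : e + (s - e) = 0 + s := by abel
    rw [t1, t2]

theorem main_cert (P : List (ℕ × ℕ × ℕ × ℕ × ℕ)) (Q : List (ℕ × ℕ)) (h : certOK v P Q = true) :
    ∃ D : DirectedDesign (Fin v) 2 4 2, D.SuperSimple ∧ D.DefiningHalf := by
  simp only [certOK, Bool.and_eq_true] at h
  obtain ⟨h2, h3, h4⟩ := h
  have h2 := Nat.eq_of_beq_eq_true h2
  have hpos : ∀ a ∈ (baseN P Q).flatMap (dlN v), a < v := by
    intro a ha
    obtain ⟨q, _, hq⟩ := List.mem_flatMap.mp ha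
    rw [dlN_eq] at hq
    obtain ⟨y, _, rfl⟩ := List.mem_map.mp hq
    exact y.isLt
  refine mkDD_half (fam v P Q) ?_ ?_ ?_ (partner v P Q) (partner_inj P Q) (partner_trade P Q)
  · intro i hi
    obtain ⟨q, hq, e⟩ := fam_mem (v := v) P Q i
    rw [e] at hi
    have h0 : (0 : Fin v).val ∈ (baseN P Q).flatMap (dlN v) := List.mem_flatMap.mpr ⟨q, hq, by
      rw [dlN_eq]; exact List.mem_map_of_mem hi⟩
    have h1 := List.count_pos_iff.mpr h0
    have h2 := check2_spec _ _ _ (0 : Fin v).val h3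
    have h4 : Nat.testBit 1 (0 : Fin v).val = true := by simp
    rw [h4] at h2
    simp only [Bool.toNat_true] at h2
    omega
  · intro δ hδ
    rw [sum_fam P Q (fun q => (dl q).count δ)]
    have hδ0 : 0 < δ.val := by
      rcases Nat.eq_zero_or_pos δ.val with h | h
      · exact absurd (Fin.ext (by simpa using h)) hδ
      · exact h
    rw [← count_eq_two hpos h2 h3 hδ0 δ.isLt, List.count_flatMap]
    congr 1
    apply List.map_congr_left
    intro q _
    simp only [Function.comp_apply, dlN_eq]
    rw [List.count_map_of_injective _ _ Fin.val_injective]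
  · intro u
    rw [sum_fam P Q (fun q => (al q).count u)]
    refine le_trans (le_of_eq ?_) (checkR_spec _ _ (code u) h4)
    rw [List.count_flatMap]
    congr 1
    apply List.map_congr_left
    intro q _
    simp only [Function.comp_apply, alN_eq]
    exact (List.count_map_of_injective (al (toF v q)) _ code_inj u).symm

end concrete

/-! ### The certificates, found by computer search -/

theorem case_136 :
    ∃ D : DirectedDesign (Fin 136) 2 4 2, D.SuperSimple ∧ D.DefiningHalf :=
  main_cert (v := 136)
    [(82, 41, 9, 49, 39), (135, 56, 121, 46, 60), (27, 62, 110, 99, 42), (61, 59, 114, 48, 42),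
    (87, 22, 123, 36, 80), (105, 33, 61, 89, 128), (106, 70, 2, 91, 56), (58, 53, 29, 6, 74),
    (93, 24, 120, 87, 65), (96, 117, 23, 92, 124), (81, 97, 69, 88, 63), (102, 26, 24, 100, 4),
    (110, 125, 12, 8, 111), (51, 123, 85, 32, 9), (105, 115, 46, 101, 64), (50, 47, 38, 45, 70),
    (126, 74, 7, 60, 56), (79, 84, 93, 33, 106), (91, 83, 86, 115, 135), (59, 29, 81, 62, 48),
    (54, 60, 13, 71, 46), (99, 78, 117, 116, 119)]
    [(11, 118)] (by decide +kernel)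

theorem case_139 :
    ∃ D : DirectedDesign (Fin 139) 2 4 2, D.SuperSimple ∧ D.DefiningHalf :=
  main_cert (v := 139)
    [(33, 76, 94, 55, 89), (89, 70, 57, 85, 94), (1, 41, 69, 21, 16), (125, 67, 6, 30, 101),
    (98, 11, 96, 79, 69), (118, 131, 105, 40, 114), (42, 93, 125, 25, 116), (31, 85, 36, 103, 28),
    (84, 131, 45, 23, 102), (77, 58, 92, 130, 37), (12, 8, 87, 104, 118), (91, 53, 42, 27, 116),
    (113, 103, 68, 62, 137), (95, 19, 130, 112, 80), (16, 72, 26, 73, 39), (11, 8, 10, 134, 112),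
    (132, 130, 48, 138, 51), (18, 30, 110, 51, 15), (6, 31, 102, 59, 117), (132, 65, 97, 31, 93),
    (76, 136, 56, 117, 52), (110, 127, 37, 90, 66), (109, 43, 39, 27, 126)]
    [] (by decide +kernel)

theorem case_277 :
    ∃ D : DirectedDesign (Fin 277) 2 4 2, D.SuperSimple ∧ D.DefiningHalf :=
  main_cert (v := 277)
    [(130, 54, 136, 167, 252), (196, 79, 112, 177, 130), (134, 119, 257, 105, 45),
    (101, 19, 219, 233, 224), (116, 249, 149, 52, 21), (71, 159, 154, 256, 237),
    (38, 28, 162, 121, 152), (242, 36, 188, 46, 19), (233, 62, 190, 179, 188),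
    (35, 142, 102, 13, 231), (217, 204, 32, 205, 169), (221, 116, 30, 88, 253),
    (197, 68, 27, 261, 106), (200, 84, 253, 1, 3), (163, 205, 156, 49, 172),
    (131, 180, 130, 160, 68), (216, 103, 87, 199, 257), (101, 64, 39, 229, 199),
    (246, 170, 59, 226, 240), (142, 211, 252, 274, 110), (208, 210, 91, 193, 166),
    (184, 121, 47, 212, 157), (234, 262, 263, 52, 178), (212, 137, 186, 104, 97),
    (46, 85, 256, 23, 210), (8, 96, 63, 12, 251), (259, 52, 99, 270, 256),
    (137, 232, 150, 171, 139), (120, 24, 175, 59, 156), (104, 1, 216, 259, 203),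
    (202, 212, 5, 266, 232), (205, 139, 214, 119, 262), (79, 83, 266, 71, 203),
    (183, 235, 188, 133, 261), (204, 94, 198, 200, 243), (93, 244, 76, 53, 115),
    (177, 235, 127, 18, 247), (127, 153, 57, 86, 252), (146, 126, 255, 158, 17),
    (220, 118, 233, 26, 85), (179, 229, 155, 55, 187), (226, 186, 224, 58, 69),
    (254, 141, 102, 217, 6), (267, 12, 7, 85, 99), (68, 165, 261, 204, 201),
    (103, 190, 139, 195, 107)]
    [] (by decide +kernel)

theorem case_280 :
    ∃ D : DirectedDesign (Fin 280) 2 4 2, D.SuperSimple ∧ D.DefiningHalf :=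
  main_cert (v := 280)
    [(30, 81, 267, 201, 22), (163, 122, 41, 207, 170), (135, 170, 5, 117, 177),
    (63, 102, 262, 93, 29), (197, 253, 106, 4, 153), (226, 59, 177, 86, 83),
    (148, 165, 223, 57, 147), (195, 252, 2, 169, 197), (121, 66, 54, 118, 246),
    (213, 112, 227, 230, 251), (192, 232, 24, 140, 58), (138, 130, 116, 100, 271),
    (203, 119, 167, 92, 123), (96, 219, 28, 183, 111), (127, 13, 205, 2, 95),
    (35, 121, 190, 251, 216), (23, 43, 82, 40, 56), (273, 241, 191, 166, 27),
    (275, 210, 61, 144, 212), (37, 267, 251, 182, 230), (46, 26, 36, 206, 49),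
    (235, 2, 202, 98, 107), (98, 101, 92, 160, 28), (52, 196, 203, 236, 151),
    (65, 82, 6, 143, 253), (60, 109, 184, 118, 164), (270, 249, 271, 175, 116),
    (191, 47, 70, 115, 97), (41, 49, 255, 178, 134), (209, 173, 105, 34, 148),
    (185, 138, 18, 209, 46), (190, 235, 32, 15, 106), (11, 179, 272, 238, 110),
    (119, 27, 174, 40, 61), (249, 269, 268, 123, 32), (69, 85, 166, 54, 223),
    (62, 211, 11, 136, 56), (172, 158, 56, 247, 73), (139, 201, 154, 97, 162),
    (55, 12, 232, 127, 19), (4, 260, 104, 206, 180), (134, 259, 207, 243, 247),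
    (194, 152, 22, 151, 16), (227, 19, 103, 76, 71), (94, 88, 24, 173, 213),
    (38, 279, 13, 138, 150)]
    [(229, 25)] (by decide +kernel)

theorem case_283 :
    ∃ D : DirectedDesign (Fin 283) 2 4 2, D.SuperSimple ∧ D.DefiningHalf :=
  main_cert (v := 283)
    [(281, 53, 279, 188, 24), (11, 12, 200, 111, 254), (260, 159, 46, 84, 128),
    (203, 97, 85, 16, 242), (21, 54, 103, 195, 56), (184, 24, 222, 223, 152),
    (238, 217, 65, 166, 168), (234, 118, 48, 155, 46), (68, 192, 116, 109, 23),
    (274, 140, 221, 216, 275), (105, 181, 212, 227, 187), (138, 166, 5, 53, 151),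
    (88, 87, 56, 271, 252), (160, 181, 250, 58, 55), (35, 164, 205, 226, 6),
    (118, 101, 37, 90, 25), (268, 77, 139, 241, 120), (210, 249, 137, 194, 135),
    (276, 104, 126, 63, 30), (231, 101, 127, 56, 123), (79, 83, 98, 237, 103),
    (150, 185, 1, 147, 275), (256, 275, 206, 67, 110), (194, 84, 156, 91, 121),
    (153, 240, 193, 162, 156), (144, 215, 57, 272, 247), (22, 276, 265, 251, 58),
    (273, 211, 65, 44, 213), (167, 263, 86, 157, 265), (169, 94, 172, 270, 5),
    (51, 163, 168, 93, 239), (122, 269, 110, 75, 67), (147, 82, 102, 253, 236),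
    (74, 135, 20, 174, 257), (279, 64, 130, 51, 202), (199, 251, 7, 260, 245),
    (36, 214, 231, 30, 20), (50, 207, 179, 259, 97), (86, 43, 252, 28, 169),
    (37, 71, 223, 59, 163), (217, 267, 175, 19, 258), (112, 64, 223, 87, 49),
    (138, 120, 278, 269, 77), (270, 190, 94, 14, 127), (34, 176, 235, 266, 63),
    (78, 154, 6, 64, 170), (141, 62, 115, 99, 132)]
    [] (by decide +kernel)

theorem case_292 :
    ∃ D : DirectedDesign (Fin 292) 2 4 2, D.SuperSimple ∧ D.DefiningHalf :=
  main_cert (v := 292)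
    [(172, 84, 198, 130, 248), (177, 225, 9, 264, 73), (270, 120, 146, 210, 241),
    (7, 291, 56, 110, 62), (13, 238, 187, 146, 239), (254, 52, 133, 119, 273),
    (41, 12, 173, 232, 179), (208, 171, 27, 5, 12), (46, 168, 132, 238, 174),
    (233, 119, 106, 117, 35), (105, 272, 229, 290, 62), (24, 235, 258, 211, 282),
    (139, 169, 83, 149, 48), (116, 259, 290, 277, 180), (197, 214, 265, 85, 242),
    (193, 3, 46, 173, 28), (27, 193, 218, 205, 23), (103, 78, 107, 153, 217),
    (286, 128, 88, 66, 148), (272, 45, 121, 102, 9), (224, 144, 153, 218, 87),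
    (109, 91, 104, 166, 133), (213, 202, 130, 65, 75), (257, 204, 150, 225, 100),
    (50, 179, 38, 2, 49), (117, 47, 89, 207, 190), (221, 253, 69, 129, 38),
    (40, 79, 103, 98, 223), (192, 267, 160, 93, 134), (226, 262, 261, 136, 230),
    (44, 18, 289, 36, 281), (236, 33, 1, 4, 41), (194, 180, 78, 278, 44), (155, 70, 285, 215, 10),
    (200, 158, 149, 186, 163), (113, 162, 52, 165, 204), (164, 247, 125, 195, 290),
    (275, 93, 28, 212, 120), (152, 23, 211, 220, 112), (276, 250, 284, 79, 215),
    (16, 21, 142, 177, 238), (74, 5, 215, 111, 59), (80, 152, 177, 18, 15),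
    (111, 36, 22, 132, 281), (96, 229, 223, 11, 145), (237, 249, 270, 219, 141),
    (169, 135, 188, 61, 46), (206, 273, 98, 289, 70)]
    [(30, 186)] (by decide +kernel)

theorem case_295 :
    ∃ D : DirectedDesign (Fin 295) 2 4 2, D.SuperSimple ∧ D.DefiningHalf :=
  main_cert (v := 295)
    [(218, 51, 45, 62, 46), (116, 86, 274, 174, 233), (223, 273, 130, 231, 154),
    (166, 19, 184, 76, 3), (226, 66, 268, 193, 11), (285, 225, 171, 258, 28),
    (210, 174, 223, 92, 214), (126, 109, 22, 117, 84), (7, 255, 293, 174, 133),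
    (118, 108, 294, 238, 23), (264, 39, 54, 12, 141), (88, 224, 139, 279, 108),
    (205, 142, 150, 180, 255), (247, 67, 24, 176, 18), (14, 40, 74, 265, 214),
    (63, 183, 215, 175, 51), (224, 221, 197, 91, 183), (125, 10, 250, 120, 66),
    (150, 263, 213, 40, 26), (272, 91, 276, 190, 158), (140, 96, 17, 8, 199),
    (30, 64, 250, 206, 282), (190, 196, 251, 58, 49), (92, 50, 11, 68, 211),
    (83, 236, 99, 189, 217), (242, 227, 280, 134, 136), (25, 134, 98, 38, 42),
    (78, 49, 214, 168, 275), (148, 66, 192, 133, 234), (20, 151, 117, 89, 141),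
    (35, 269, 195, 227, 129), (209, 248, 8, 225, 65), (33, 62, 60, 283, 46),
    (138, 36, 139, 195, 11), (149, 31, 261, 6, 60), (37, 160, 32, 151, 62),
    (243, 179, 48, 215, 88), (288, 276, 173, 259, 146), (107, 164, 68, 102, 101),
    (208, 102, 219, 286, 70), (35, 14, 234, 274, 179), (99, 267, 47, 53, 56),
    (184, 153, 74, 292, 208), (198, 93, 194, 41, 125), (83, 26, 130, 37, 219),
    (22, 17, 110, 294, 276), (91, 173, 231, 239, 139), (201, 266, 134, 274, 56),
    (228, 79, 246, 95, 97)]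
    [] (by decide +kernel)

theorem case_298 :
    ∃ D : DirectedDesign (Fin 298) 2 4 2, D.SuperSimple ∧ D.DefiningHalf :=
  main_cert (v := 298)
    [(200, 91, 87, 110, 277), (173, 33, 35, 130, 99), (65, 113, 179, 247, 260),
    (126, 202, 68, 1, 62), (174, 292, 82, 76, 36), (253, 135, 190, 7, 276),
    (147, 79, 199, 233, 167), (265, 262, 244, 266, 261), (203, 243, 231, 284, 287),
    (282, 99, 252, 224, 251), (254, 164, 49, 286, 150), (256, 114, 181, 153, 222),
    (204, 296, 68, 214, 189), (205, 59, 122, 35, 61), (177, 239, 25, 97, 8),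
    (182, 155, 106, 229, 17), (102, 219, 148, 179, 209), (231, 104, 261, 22, 296),
    (97, 89, 128, 223, 202), (295, 70, 132, 57, 165), (9, 10, 57, 104, 78),
    (19, 261, 55, 74, 215), (10, 29, 255, 284, 193), (51, 192, 267, 220, 171),
    (60, 225, 77, 131, 19), (142, 143, 15, 122, 164), (17, 219, 180, 104, 63),
    (110, 139, 246, 25, 88), (72, 193, 292, 85, 175), (291, 184, 137, 81, 87),
    (189, 225, 163, 165, 117), (54, 173, 214, 28, 168), (266, 7, 127, 80, 130),
    (82, 182, 18, 123, 273), (197, 213, 256, 14, 242), (27, 149, 12, 275, 280),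
    (166, 53, 260, 43, 129), (44, 96, 105, 225, 39), (64, 152, 218, 186, 172),
    (198, 137, 283, 11, 170), (11, 108, 250, 24, 155), (263, 78, 229, 51, 57),
    (58, 79, 49, 160, 132), (174, 187, 81, 140, 227), (294, 228, 282, 238, 188),
    (40, 197, 38, 227, 90), (153, 293, 264, 221, 100), (278, 129, 175, 18, 197),
    (275, 95, 242, 218, 120)]
    [(83, 8)] (by decide +kernel)

theorem case_301 :
    ∃ D : DirectedDesign (Fin 301) 2 4 2, D.SuperSimple ∧ D.DefiningHalf :=
  main_cert (v := 301)
    [(209, 203, 207, 56, 45), (29, 231, 96, 31, 218), (62, 86, 234, 61, 19), (9, 167, 83, 176, 47),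
    (224, 145, 128, 16, 7), (160, 193, 1, 152, 292), (73, 247, 10, 287, 151),
    (8, 261, 220, 124, 231), (269, 130, 44, 291, 79), (173, 180, 176, 68, 150),
    (257, 6, 202, 210, 153), (80, 278, 13, 90, 210), (126, 276, 97, 69, 123),
    (155, 75, 147, 77, 274), (120, 46, 255, 83, 297), (60, 251, 90, 296, 11),
    (152, 179, 267, 47, 68), (179, 24, 260, 279, 49), (116, 95, 289, 143, 85),
    (248, 208, 46, 203, 169), (178, 248, 157, 127, 17), (198, 56, 287, 186, 160),
    (195, 237, 123, 132, 200), (294, 228, 257, 165, 90), (266, 212, 92, 24, 158),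
    (295, 220, 96, 235, 18), (111, 88, 133, 166, 144), (5, 19, 144, 131, 35),
    (225, 300, 188, 25, 63), (268, 34, 21, 164, 183), (262, 160, 55, 169, 237),
    (59, 58, 74, 224, 250), (58, 214, 55, 86, 198), (39, 168, 165, 148, 121),
    (56, 81, 121, 60, 244), (52, 152, 259, 208, 15), (240, 176, 110, 10, 260),
    (163, 80, 197, 271, 251), (119, 216, 28, 289, 207), (195, 143, 124, 134, 290),
    (164, 121, 184, 266, 98), (138, 151, 20, 97, 115), (239, 256, 40, 270, 157),
    (69, 263, 117, 51, 170), (26, 253, 255, 76, 299), (32, 43, 159, 232, 284),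
    (286, 258, 71, 100, 214), (109, 168, 73, 30, 14), (154, 244, 42, 203, 190),
    (183, 48, 36, 201, 248)]
    [] (by decide +kernel)

theorem case_409 :
    ∃ D : DirectedDesign (Fin 409) 2 4 2, D.SuperSimple ∧ D.DefiningHalf :=
  main_cert (v := 409)
    [(39, 2, 405, 235, 241), (81, 114, 393, 122, 144), (113, 317, 264, 254, 29),
    (305, 249, 102, 23, 138), (240, 67, 19, 399, 79), (255, 252, 288, 26, 33),
    (52, 145, 120, 300, 223), (204, 395, 304, 13, 272), (381, 12, 131, 316, 231),
    (45, 76, 71, 55, 47), (203, 109, 63, 168, 70), (329, 200, 303, 189, 330),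
    (333, 151, 1, 204, 330), (106, 358, 115, 208, 296), (299, 295, 133, 191, 117),
    (215, 285, 165, 282, 257), (301, 170, 216, 256, 200), (112, 394, 310, 136, 31),
    (357, 159, 234, 212, 372), (38, 291, 270, 18, 312), (398, 365, 230, 386, 191),
    (126, 260, 90, 288, 124), (381, 58, 235, 86, 298), (327, 5, 277, 213, 220),
    (123, 22, 331, 132, 345), (238, 246, 402, 122, 324), (377, 98, 374, 337, 353),
    (182, 147, 51, 261, 81), (321, 196, 31, 343, 73), (181, 186, 344, 40, 342),
    (403, 15, 367, 231, 210), (116, 142, 211, 12, 210), (246, 226, 74, 97, 57),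
    (271, 378, 275, 68, 251), (298, 150, 61, 255, 104), (167, 77, 272, 185, 401),
    (96, 326, 138, 265, 254), (44, 146, 17, 317, 270), (34, 368, 255, 72, 388),
    (269, 326, 117, 225, 345), (288, 13, 143, 93, 63), (59, 106, 149, 64, 13),
    (377, 91, 268, 59, 315), (29, 263, 63, 119, 311), (310, 283, 372, 398, 379),
    (143, 97, 351, 327, 108), (135, 68, 162, 324, 252), (291, 50, 329, 353, 287),
    (224, 58, 57, 95, 155), (10, 25, 142, 344, 249), (53, 41, 267, 367, 370),
    (360, 260, 344, 323, 336), (54, 385, 266, 331, 115), (110, 55, 71, 19, 199),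
    (245, 293, 270, 98, 172), (14, 231, 281, 170, 101), (187, 366, 27, 379, 136),
    (9, 1, 298, 272, 82), (165, 99, 322, 147, 219), (60, 325, 96, 386, 284),
    (176, 18, 276, 362, 71), (181, 174, 261, 306, 45), (233, 59, 361, 109, 297),
    (128, 338, 54, 62, 368), (49, 201, 171, 285, 20), (17, 351, 349, 194, 247),
    (173, 156, 348, 159, 207), (153, 231, 19, 92, 22)]
    [] (by decide +kernel)

theorem case_412 :
    ∃ D : DirectedDesign (Fin 412) 2 4 2, D.SuperSimple ∧ D.DefiningHalf :=
  main_cert (v := 412)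
    [(341, 167, 124, 89, 304), (203, 312, 377, 275, 401), (269, 371, 25, 212, 29),
    (21, 1, 8, 172, 67), (348, 266, 323, 321, 402), (150, 278, 6, 69, 280),
    (173, 350, 146, 7, 106), (161, 53, 213, 191, 170), (104, 231, 352, 8, 205),
    (267, 34, 256, 387, 120), (107, 280, 263, 94, 183), (139, 369, 198, 225, 258),
    (47, 206, 78, 1, 185), (242, 176, 295, 396, 193), (310, 309, 251, 7, 284),
    (186, 280, 373, 405, 395), (400, 384, 157, 208, 295), (188, 112, 234, 213, 24),
    (141, 18, 217, 249, 233), (136, 72, 310, 289, 2), (249, 335, 376, 205, 111),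
    (329, 226, 409, 147, 69), (129, 260, 172, 214, 160), (357, 161, 239, 122, 57),
    (188, 256, 378, 343, 63), (38, 202, 171, 169, 151), (245, 407, 30, 206, 317),
    (383, 69, 157, 92, 370), (115, 275, 227, 371, 374), (241, 101, 219, 406, 88),
    (328, 287, 110, 268, 326), (325, 126, 166, 299, 304), (254, 201, 22, 353, 207),
    (298, 360, 368, 388, 13), (106, 138, 64, 157, 296), (34, 319, 264, 6, 113),
    (243, 39, 294, 142, 333), (314, 165, 74, 351, 291), (27, 43, 162, 349, 384),
    (379, 275, 249, 306, 244), (191, 151, 236, 187, 336), (15, 247, 215, 33, 210),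
    (337, 15, 29, 356, 133), (216, 363, 331, 124, 370), (253, 376, 22, 360, 176),
    (313, 196, 250, 282, 294), (83, 333, 10, 74, 358), (45, 356, 289, 346, 211),
    (347, 286, 233, 164, 158), (231, 194, 180, 254, 56), (175, 223, 353, 299, 35),
    (3, 100, 85, 312, 260), (270, 365, 279, 115, 411), (131, 272, 316, 26, 150),
    (220, 404, 366, 202, 262), (344, 287, 144, 202, 295), (82, 225, 302, 68, 380),
    (116, 136, 373, 144, 194), (362, 364, 342, 61, 407), (401, 316, 56, 292, 98),
    (75, 265, 339, 242, 12), (110, 286, 133, 207, 112), (17, 342, 79, 217, 136),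
    (97, 388, 48, 9, 5), (84, 103, 154, 264, 80), (234, 368, 354, 339, 23),
    (80, 273, 151, 50, 40), (321, 317, 341, 77, 351)]
    [(283, 36)] (by decide +kernel)

theorem case_415 :
    ∃ D : DirectedDesign (Fin 415) 2 4 2, D.SuperSimple ∧ D.DefiningHalf :=
  main_cert (v := 415)
    [(91, 321, 176, 89, 170), (272, 118, 51, 162, 370), (314, 212, 122, 166, 216),
    (25, 123, 14, 303, 358), (201, 264, 114, 117, 179), (122, 72, 289, 121, 294),
    (202, 3, 378, 198, 315), (36, 407, 383, 192, 193), (35, 363, 393, 210, 38),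
    (210, 166, 365, 250, 178), (159, 397, 161, 259, 34), (132, 190, 170, 389, 52),
    (320, 327, 131, 378, 367), (393, 290, 251, 138, 348), (116, 411, 388, 152, 336),
    (54, 189, 59, 289, 403), (129, 206, 397, 77, 366), (107, 318, 349, 15, 150),
    (39, 71, 408, 297, 114), (266, 275, 218, 116, 268), (78, 402, 413, 214, 61),
    (115, 241, 386, 402, 98), (264, 158, 93, 386, 27), (295, 183, 171, 165, 156),
    (161, 321, 385, 95, 261), (342, 162, 249, 405, 247), (269, 348, 128, 107, 81),
    (139, 53, 331, 358, 376), (76, 117, 203, 1, 262), (282, 269, 285, 272, 252),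
    (7, 172, 106, 71, 167), (228, 276, 44, 363, 82), (14, 294, 104, 79, 5),
    (169, 8, 305, 224, 230), (374, 19, 24, 291, 47), (206, 314, 74, 312, 354),
    (346, 290, 11, 236, 127), (281, 50, 97, 85, 217), (277, 160, 311, 218, 48),
    (292, 81, 104, 56, 162), (355, 296, 23, 128, 45), (343, 262, 220, 62, 362),
    (326, 207, 74, 354, 400), (85, 26, 47, 391, 260), (82, 275, 352, 377, 395),
    (340, 149, 361, 110, 129), (248, 389, 93, 202, 34), (31, 127, 353, 213, 207),
    (387, 382, 58, 230, 234), (43, 258, 250, 217, 242), (197, 148, 107, 25, 229),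
    (71, 339, 68, 86, 51), (105, 351, 384, 69, 163), (6, 405, 313, 352, 114),
    (382, 331, 398, 277, 37), (182, 332, 252, 53, 300), (42, 55, 235, 173, 313),
    (278, 37, 27, 263, 12), (49, 100, 274, 294, 270), (273, 181, 177, 70, 104),
    (303, 70, 56, 326, 215), (29, 263, 119, 223, 206), (342, 40, 187, 55, 299),
    (215, 88, 28, 314, 261), (347, 234, 40, 159, 158), (111, 8, 92, 275, 259),
    (99, 232, 319, 45, 176), (318, 394, 44, 193, 306), (291, 35, 62, 321, 312)]
    [] (by decide +kernel)

theorem case_424 :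
    ∃ D : DirectedDesign (Fin 424) 2 4 2, D.SuperSimple ∧ D.DefiningHalf :=
  main_cert (v := 424)
    [(419, 19, 321, 381, 222), (20, 371, 8, 194, 330), (4, 265, 7, 178, 291),
    (217, 6, 77, 86, 404), (104, 329, 252, 254, 280), (90, 231, 322, 215, 403),
    (23, 186, 45, 278, 51), (73, 132, 273, 84, 45), (333, 11, 70, 342, 135),
    (360, 45, 417, 20, 250), (332, 181, 27, 358, 144), (103, 189, 408, 175, 86),
    (401, 127, 97, 60, 306), (258, 179, 327, 225, 80), (29, 415, 129, 318, 399),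
    (137, 319, 247, 415, 218), (339, 211, 7, 129, 184), (18, 46, 392, 92, 344),
    (170, 232, 93, 328, 285), (389, 393, 241, 342, 348), (69, 135, 303, 54, 196),
    (180, 369, 104, 130, 33), (226, 169, 191, 275, 199), (30, 187, 242, 123, 298),
    (114, 101, 354, 295, 281), (318, 209, 222, 388, 221), (248, 50, 261, 294, 117),
    (349, 160, 285, 416, 415), (300, 164, 196, 58, 317), (36, 380, 365, 341, 118),
    (384, 268, 16, 169, 345), (115, 346, 377, 386, 326), (259, 310, 49, 68, 15),
    (58, 328, 167, 32, 395), (304, 301, 299, 317, 210), (63, 75, 386, 351, 409),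
    (277, 122, 255, 230, 110), (292, 192, 420, 390, 108), (381, 175, 224, 143, 99),
    (61, 80, 195, 364, 308), (65, 152, 164, 107, 307), (216, 52, 84, 218, 266),
    (356, 171, 168, 152, 81), (156, 63, 416, 387, 181), (378, 99, 362, 179, 36),
    (384, 193, 365, 12, 155), (153, 54, 330, 216, 321), (187, 112, 180, 300, 25),
    (10, 287, 86, 329, 138), (234, 215, 216, 27, 51), (173, 254, 298, 83, 273),
    (42, 116, 355, 129, 130), (222, 89, 185, 243, 219), (264, 414, 385, 26, 134),
    (62, 345, 224, 414, 312), (33, 35, 194, 183, 272), (171, 376, 223, 160, 146),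
    (88, 323, 77, 221, 116), (37, 78, 229, 408, 149), (34, 157, 393, 394, 340),
    (403, 183, 337, 24, 331), (280, 282, 333, 266, 157), (145, 407, 14, 269, 311),
    (302, 402, 17, 297, 357), (56, 184, 74, 168, 57), (140, 266, 219, 313, 6),
    (108, 102, 173, 135, 336), (48, 383, 293, 175, 245), (85, 390, 186, 134, 126),
    (286, 57, 140, 74, 380)]
    [(67, 221)] (by decide +kernel)

theorem case_427 :
    ∃ D : DirectedDesign (Fin 427) 2 4 2, D.SuperSimple ∧ D.DefiningHalf :=
  main_cert (v := 427)
    [(330, 372, 100, 130, 147), (102, 324, 230, 342, 273), (416, 20, 27, 373, 255),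
    (15, 257, 173, 58, 404), (237, 49, 31, 48, 122), (262, 338, 190, 47, 167),
    (114, 397, 73, 322, 363), (162, 89, 39, 245, 243), (49, 312, 211, 33, 29),
    (6, 73, 86, 358, 97), (383, 233, 288, 369, 246), (256, 9, 156, 206, 132),
    (266, 17, 203, 257, 196), (96, 91, 16, 145, 186), (319, 210, 12, 22, 34),
    (408, 44, 24, 374, 248), (353, 410, 102, 204, 263), (135, 180, 298, 203, 40),
    (320, 286, 108, 119, 122), (187, 175, 166, 56, 302), (150, 136, 25, 164, 359),
    (339, 372, 4, 246, 155), (293, 373, 272, 382, 99), (133, 106, 358, 337, 273),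
    (316, 77, 342, 233, 256), (159, 241, 368, 295, 182), (350, 136, 322, 244, 190),
    (301, 78, 112, 160, 104), (195, 109, 247, 268, 37), (379, 65, 122, 366, 151),
    (98, 262, 192, 375, 196), (129, 362, 286, 156, 167), (149, 156, 362, 326, 26),
    (163, 244, 61, 329, 358), (401, 99, 227, 93, 10), (422, 249, 315, 75, 30),
    (211, 366, 143, 201, 380), (199, 234, 411, 252, 348), (348, 40, 129, 344, 31),
    (426, 145, 242, 62, 390), (40, 8, 182, 10, 395), (323, 333, 130, 20, 127),
    (294, 207, 345, 67, 42), (238, 274, 267, 50, 399), (288, 388, 112, 225, 346),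
    (402, 342, 62, 369, 52), (172, 148, 88, 181, 35), (169, 35, 255, 16, 222),
    (168, 109, 165, 100, 103), (270, 404, 334, 365, 131), (322, 409, 337, 335, 367),
    (276, 210, 54, 397, 192), (226, 273, 348, 113, 405), (121, 203, 50, 406, 279),
    (192, 56, 270, 399, 88), (376, 363, 21, 41, 87), (143, 37, 6, 125, 124),
    (46, 319, 321, 356, 174), (144, 146, 360, 317, 120), (71, 384, 174, 109, 57),
    (310, 281, 380, 143, 316), (236, 48, 124, 51, 19), (66, 345, 259, 158, 326),
    (311, 299, 296, 170, 4), (198, 351, 18, 385, 374), (140, 383, 132, 177, 292),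
    (225, 365, 5, 227, 372), (388, 91, 310, 236, 219), (218, 370, 27, 334, 33),
    (419, 420, 282, 28, 296), (309, 199, 177, 24, 405)]
    [] (by decide +kernel)

theorem case_430 :
    ∃ D : DirectedDesign (Fin 430) 2 4 2, D.SuperSimple ∧ D.DefiningHalf :=
  main_cert (v := 430)
    [(402, 206, 187, 265, 372), (34, 169, 286, 267, 294), (336, 259, 235, 230, 184),
    (35, 92, 29, 47, 314), (385, 265, 285, 102, 264), (99, 391, 131, 176, 139),
    (240, 136, 209, 311, 65), (235, 21, 228, 368, 251), (133, 395, 270, 206, 92),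
    (161, 290, 351, 86, 317), (165, 167, 356, 201, 329), (128, 345, 69, 223, 337),
    (248, 206, 122, 148, 23), (268, 99, 340, 76, 384), (152, 166, 215, 11, 424),
    (9, 8, 231, 206, 70), (131, 65, 25, 42, 348), (377, 287, 43, 274, 38), (292, 9, 40, 411, 153),
    (79, 141, 296, 76, 191), (220, 124, 70, 8, 130), (346, 370, 263, 418, 18),
    (148, 332, 273, 112, 110), (397, 26, 398, 230, 307), (103, 238, 349, 132, 408),
    (218, 237, 417, 288, 41), (426, 228, 378, 44, 428), (380, 323, 313, 314, 236),
    (277, 29, 368, 26, 14), (32, 321, 291, 257, 269), (5, 408, 59, 135, 388),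
    (287, 268, 355, 142, 298), (355, 37, 304, 181, 415), (157, 406, 11, 177, 187),
    (104, 127, 117, 4, 370), (67, 415, 294, 416, 175), (97, 408, 177, 93, 80),
    (393, 280, 372, 114, 315), (335, 86, 262, 277, 366), (176, 18, 220, 217, 284),
    (296, 210, 312, 20, 353), (173, 64, 239, 392, 399), (303, 260, 386, 390, 193),
    (179, 79, 87, 307, 383), (361, 202, 226, 164, 235), (63, 85, 106, 212, 319),
    (342, 299, 274, 232, 306), (51, 383, 208, 52, 420), (72, 424, 140, 280, 214),
    (96, 256, 230, 3, 105), (132, 240, 320, 348, 403), (149, 269, 20, 386, 318),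
    (244, 349, 341, 300, 262), (159, 327, 88, 344, 99), (375, 403, 78, 232, 227),
    (3, 245, 104, 382, 123), (45, 264, 70, 174, 160), (155, 49, 250, 270, 183),
    (56, 279, 243, 301, 267), (397, 208, 85, 356, 170), (83, 154, 325, 310, 321),
    (53, 257, 236, 146, 429), (414, 57, 329, 7, 49), (145, 158, 34, 127, 225),
    (380, 286, 94, 332, 216), (258, 39, 169, 182, 322), (317, 369, 229, 198, 312),
    (391, 309, 17, 242, 384), (209, 405, 356, 118, 183), (252, 361, 52, 424, 407),
    (250, 139, 84, 54, 279)]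
    [(15, 293)] (by decide +kernel)

theorem case_433 :
    ∃ D : DirectedDesign (Fin 433) 2 4 2, D.SuperSimple ∧ D.DefiningHalf :=
  main_cert (v := 433)
    [(23, 58, 126, 70, 414), (220, 273, 416, 399, 139), (310, 367, 208, 6, 315),
    (70, 203, 169, 288, 60), (362, 285, 255, 270, 326), (331, 32, 379, 332, 411),
    (68, 337, 29, 260, 157), (246, 109, 147, 98, 302), (132, 290, 323, 276, 118),
    (182, 370, 59, 14, 303), (411, 136, 3, 114, 211), (132, 357, 382, 125, 65),
    (427, 359, 41, 154, 162), (390, 238, 305, 351, 229), (317, 240, 382, 432, 248),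
    (100, 278, 330, 273, 92), (129, 403, 272, 323, 392), (360, 156, 10, 241, 317),
    (170, 160, 91, 3, 48), (322, 243, 269, 15, 34), (88, 385, 238, 293, 370),
    (181, 361, 421, 379, 238), (327, 171, 275, 143, 217), (278, 391, 362, 269, 206),
    (95, 64, 351, 281, 142), (348, 388, 129, 165, 355), (336, 66, 228, 107, 74),
    (49, 94, 360, 431, 257), (117, 27, 298, 87, 18), (176, 264, 154, 20, 78),
    (11, 73, 292, 429, 120), (18, 248, 48, 41, 115), (28, 135, 166, 19, 163),
    (387, 145, 108, 19, 325), (153, 197, 299, 228, 298), (13, 28, 33, 188, 313),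
    (398, 209, 92, 283, 221), (285, 138, 227, 64, 67), (378, 5, 266, 237, 250),
    (422, 233, 1, 426, 230), (53, 358, 202, 296, 191), (374, 282, 186, 46, 395),
    (153, 417, 218, 116, 196), (219, 350, 231, 399, 202), (353, 408, 50, 1, 216),
    (284, 267, 184, 233, 62), (372, 91, 78, 291, 387), (210, 300, 389, 131, 337),
    (187, 234, 429, 78, 82), (104, 293, 207, 391, 130), (172, 54, 379, 38, 427),
    (338, 421, 72, 224, 348), (29, 226, 324, 50, 343), (201, 24, 424, 8, 57),
    (121, 23, 247, 346, 222), (31, 279, 220, 67, 412), (377, 375, 193, 265, 175),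
    (239, 401, 314, 173, 320), (26, 409, 296, 293, 35), (14, 322, 267, 212, 383),
    (327, 100, 236, 7, 310), (112, 388, 76, 149, 417), (393, 77, 159, 372, 150),
    (413, 155, 329, 8, 94), (417, 164, 291, 235, 134), (94, 199, 157, 99, 268),
    (24, 210, 212, 27, 292), (340, 139, 101, 161, 322), (151, 392, 367, 64, 178),
    (120, 44, 71, 340, 376), (32, 118, 372, 248, 72), (394, 342, 159, 170, 396)]
    [] (by decide +kernel)

theorem case_436 :
    ∃ D : DirectedDesign (Fin 436) 2 4 2, D.SuperSimple ∧ D.DefiningHalf :=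
  main_cert (v := 436)
    [(225, 344, 379, 261, 426), (387, 108, 383, 164, 15), (427, 50, 162, 183, 268),
    (12, 144, 118, 405, 152), (262, 164, 229, 305, 73), (79, 73, 146, 5, 385),
    (15, 405, 183, 419, 301), (219, 75, 1, 315, 289), (105, 337, 3, 79, 336),
    (65, 24, 315, 58, 81), (148, 209, 118, 394, 197), (408, 228, 413, 173, 47),
    (252, 141, 18, 329, 241), (80, 231, 347, 165, 54), (250, 186, 91, 116, 92),
    (87, 283, 331, 332, 370), (162, 346, 15, 67, 395), (158, 85, 181, 175, 113),
    (182, 188, 416, 346, 150), (249, 265, 5, 311, 350), (406, 179, 145, 382, 226),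
    (69, 388, 129, 390, 70), (221, 358, 96, 357, 297), (353, 335, 123, 325, 102),
    (117, 2, 309, 6, 402), (381, 90, 4, 216, 61), (257, 18, 27, 68, 309),
    (39, 282, 336, 365, 143), (369, 178, 225, 407, 20), (100, 57, 373, 125, 399),
    (264, 425, 33, 368, 52), (94, 356, 188, 39, 22), (130, 371, 182, 90, 376),
    (259, 385, 82, 172, 103), (128, 25, 417, 31, 66), (313, 276, 43, 273, 314),
    (383, 36, 46, 2, 82), (266, 95, 6, 350, 3), (187, 329, 253, 423, 281), (343, 233, 362, 4, 35),
    (45, 64, 300, 199, 327), (359, 216, 230, 199, 57), (119, 127, 404, 27, 137),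
    (108, 109, 423, 190, 24), (161, 101, 78, 359, 319), (424, 258, 283, 176, 44),
    (84, 327, 76, 428, 225), (210, 403, 291, 97, 414), (155, 258, 422, 287, 236),
    (29, 170, 99, 194, 214), (324, 193, 143, 434, 25), (72, 314, 44, 242, 133),
    (269, 198, 417, 276, 323), (399, 394, 159, 182, 284), (386, 288, 389, 88, 140),
    (16, 38, 114, 200, 283), (124, 364, 231, 134, 333), (402, 195, 173, 423, 305),
    (245, 216, 70, 107, 189), (234, 223, 221, 114, 8), (361, 138, 212, 163, 297),
    (78, 390, 230, 374, 235), (68, 306, 377, 380, 35), (126, 143, 268, 338, 106),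
    (415, 316, 280, 367, 216), (167, 36, 140, 32, 280), (279, 133, 194, 228, 286),
    (394, 136, 21, 383, 96), (422, 377, 122, 214, 432), (114, 207, 121, 152, 209),
    (373, 370, 81, 267, 176), (256, 427, 163, 304, 41)]
    [(378, 88)] (by decide +kernel)

theorem case_439 :
    ∃ D : DirectedDesign (Fin 439) 2 4 2, D.SuperSimple ∧ D.DefiningHalf :=
  main_cert (v := 439)
    [(365, 286, 243, 405, 377), (352, 437, 254, 256, 337), (368, 315, 197, 22, 166),
    (131, 222, 380, 298, 110), (389, 67, 270, 82, 126), (98, 399, 376, 198, 245),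
    (296, 277, 15, 388, 206), (202, 43, 290, 118, 156), (153, 206, 66, 344, 409),
    (48, 307, 221, 356, 173), (111, 174, 400, 428, 217), (148, 291, 177, 139, 170),
    (142, 373, 81, 101, 268), (369, 262, 344, 428, 134), (151, 226, 230, 37, 426),
    (7, 232, 161, 379, 370), (312, 106, 162, 210, 415), (10, 180, 398, 74, 145),
    (227, 435, 351, 338, 283), (416, 10, 217, 266, 224), (197, 246, 295, 353, 430),
    (406, 3, 412, 295, 122), (16, 188, 236, 14, 347), (220, 245, 366, 251, 425),
    (61, 438, 154, 160, 349), (216, 426, 319, 174, 117), (252, 105, 355, 404, 92),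
    (323, 125, 401, 243, 300), (263, 109, 19, 332, 5), (119, 136, 249, 339, 287),
    (65, 375, 360, 290, 193), (82, 46, 166, 9, 179), (438, 198, 94, 6, 433),
    (310, 53, 198, 345, 366), (184, 118, 50, 396, 46), (367, 35, 62, 27, 371),
    (302, 411, 26, 29, 58), (113, 324, 308, 305, 142), (271, 330, 122, 375, 54),
    (45, 191, 403, 161, 112), (191, 394, 136, 31, 324), (167, 264, 128, 181, 209),
    (274, 25, 172, 347, 254), (110, 78, 315, 335, 51), (362, 367, 407, 85, 379),
    (18, 261, 193, 387, 164), (259, 331, 24, 60, 289), (413, 14, 12, 171, 299),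
    (228, 27, 245, 96, 21), (392, 395, 166, 435, 230), (186, 106, 175, 271, 10),
    (135, 179, 287, 382, 69), (431, 318, 181, 125, 143), (169, 64, 382, 278, 245),
    (141, 55, 178, 417, 409), (319, 316, 404, 353, 299), (300, 421, 101, 423, 403),
    (96, 363, 261, 62, 438), (309, 12, 414, 70, 335), (138, 196, 405, 49, 184),
    (179, 379, 418, 105, 67), (182, 298, 221, 128, 352), (41, 322, 415, 94, 89),
    (13, 76, 361, 384, 283), (91, 436, 250, 286, 83), (201, 232, 358, 360, 44),
    (235, 254, 99, 252, 246), (52, 185, 28, 160, 20), (164, 7, 215, 253, 402),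
    (80, 2, 264, 329, 19), (339, 251, 124, 58, 114), (364, 42, 125, 306, 216),
    (324, 356, 309, 165, 187)]
    [] (by decide +kernel)

theorem case_442 :
    ∃ D : DirectedDesign (Fin 442) 2 4 2, D.SuperSimple ∧ D.DefiningHalf :=
  main_cert (v := 442)
    [(368, 367, 201, 67, 70), (228, 158, 327, 174, 180), (294, 340, 243, 413, 382),
    (134, 83, 344, 358, 220), (278, 291, 402, 128, 153), (393, 160, 430, 50, 208),
    (219, 112, 181, 338, 76), (200, 239, 386, 218, 27), (354, 78, 181, 136, 72),
    (96, 267, 1, 133, 326), (386, 35, 90, 123, 186), (115, 328, 370, 94, 363),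
    (73, 62, 263, 3, 311), (435, 83, 93, 123, 398), (296, 252, 388, 400, 378),
    (58, 257, 52, 32, 91), (145, 425, 65, 13, 131), (217, 241, 197, 294, 111),
    (13, 377, 97, 252, 152), (112, 75, 249, 212, 221), (71, 395, 54, 206, 161),
    (7, 214, 390, 239, 30), (206, 299, 415, 287, 195), (159, 420, 81, 218, 36),
    (401, 31, 76, 28, 156), (376, 333, 394, 62, 92), (101, 178, 120, 425, 191),
    (154, 67, 311, 370, 310), (387, 32, 440, 265, 360), (313, 264, 378, 39, 408),
    (124, 3, 243, 153, 281), (170, 198, 144, 30, 356), (366, 390, 69, 146, 251),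
    (155, 135, 102, 246, 408), (110, 317, 102, 79, 278), (152, 324, 293, 399, 71),
    (270, 417, 337, 68, 333), (211, 208, 192, 188, 176), (229, 133, 277, 425, 275),
    (402, 316, 139, 259, 21), (4, 12, 68, 267, 424), (316, 184, 51, 393, 409),
    (182, 419, 107, 432, 15), (428, 385, 168, 337, 145), (4, 280, 353, 6, 410),
    (406, 343, 258, 157, 147), (426, 30, 70, 19, 104), (433, 122, 282, 277, 304),
    (363, 77, 51, 210, 176), (434, 424, 307, 74, 345), (127, 332, 361, 84, 169),
    (140, 98, 151, 353, 414), (117, 250, 302, 84, 220), (45, 278, 273, 111, 437),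
    (223, 110, 198, 420, 143), (163, 108, 149, 68, 142), (258, 345, 119, 196, 371),
    (293, 106, 312, 67, 422), (163, 220, 341, 307, 24), (348, 80, 241, 178, 28),
    (154, 193, 306, 175, 344), (253, 205, 2, 161, 227), (171, 63, 284, 103, 256),
    (194, 232, 336, 440, 308), (262, 238, 389, 367, 112), (247, 20, 58, 147, 106),
    (202, 322, 433, 343, 155), (441, 125, 137, 46, 124), (382, 188, 123, 138, 335),
    (15, 359, 320, 269, 200), (392, 381, 166, 333, 348), (108, 385, 380, 137, 102),
    (142, 359, 238, 174, 231)]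
    [(230, 235)] (by decide +kernel)

theorem case_445 :
    ∃ D : DirectedDesign (Fin 445) 2 4 2, D.SuperSimple ∧ D.DefiningHalf :=
  main_cert (v := 445)
    [(71, 329, 404, 367, 402), (131, 254, 327, 249, 87), (133, 326, 110, 134, 232),
    (181, 58, 26, 444, 203), (25, 402, 274, 383, 319), (243, 32, 383, 125, 433),
    (188, 212, 30, 410, 284), (79, 270, 212, 138, 127), (5, 22, 71, 67, 164),
    (304, 68, 313, 231, 223), (288, 342, 26, 280, 114), (65, 98, 17, 376, 215),
    (380, 416, 334, 337, 292), (313, 394, 218, 334, 151), (246, 305, 109, 2, 20),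
    (25, 31, 273, 394, 72), (215, 399, 247, 248, 119), (379, 370, 237, 143, 295),
    (164, 28, 160, 431, 92), (417, 430, 329, 350, 244), (385, 232, 15, 238, 3),
    (438, 441, 282, 54, 248), (190, 393, 174, 53, 169), (343, 235, 176, 90, 50),
    (167, 318, 375, 324, 307), (365, 191, 211, 185, 41), (434, 80, 117, 314, 285),
    (19, 344, 139, 259, 263), (241, 418, 338, 234, 191), (146, 390, 333, 340, 31),
    (373, 27, 18, 429, 353), (194, 39, 224, 216, 393), (398, 74, 427, 367, 237),
    (232, 323, 378, 115, 253), (158, 311, 23, 97, 39), (304, 431, 1, 310, 165),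
    (411, 272, 336, 360, 243), (207, 46, 171, 100, 295), (360, 83, 210, 351, 315),
    (93, 332, 317, 305, 352), (195, 86, 359, 435, 375), (24, 241, 154, 73, 350),
    (189, 298, 301, 166, 366), (405, 291, 368, 70, 111), (411, 102, 367, 382, 293),
    (209, 16, 21, 169, 340), (53, 369, 143, 117, 56), (218, 113, 272, 273, 231),
    (100, 46, 367, 186, 362), (143, 435, 38, 6, 187), (94, 415, 82, 341, 220),
    (368, 86, 122, 400, 18), (330, 100, 228, 182, 357), (338, 113, 155, 35, 228),
    (223, 315, 371, 171, 408), (200, 11, 366, 220, 71), (356, 443, 142, 441, 202),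
    (156, 58, 322, 331, 432), (50, 347, 298, 1, 160), (361, 187, 104, 412, 93),
    (106, 64, 325, 426, 139), (388, 108, 415, 12, 68), (135, 69, 410, 73, 342),
    (103, 185, 227, 378, 113), (99, 8, 349, 375, 443), (206, 426, 280, 39, 31),
    (179, 172, 156, 384, 390), (431, 253, 39, 210, 24), (323, 144, 419, 404, 321),
    (261, 233, 170, 82, 45), (162, 309, 296, 386, 17), (163, 440, 111, 74, 247),
    (38, 285, 216, 423, 26), (145, 337, 189, 435, 242)]
    [] (by decide +kernel)

theorem case_448 :
    ∃ D : DirectedDesign (Fin 448) 2 4 2, D.SuperSimple ∧ D.DefiningHalf :=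
  main_cert (v := 448)
    [(279, 394, 130, 427, 407), (281, 309, 243, 169, 234), (229, 405, 435, 250, 244),
    (316, 247, 368, 263, 51), (128, 273, 258, 21, 105), (194, 12, 407, 424, 149),
    (202, 326, 275, 9, 412), (147, 407, 129, 97, 434), (81, 346, 44, 310, 390),
    (365, 291, 181, 216, 130), (222, 445, 106, 162, 7), (414, 128, 150, 78, 39),
    (36, 147, 321, 156, 162), (75, 311, 267, 208, 120), (225, 101, 434, 423, 232),
    (114, 317, 65, 197, 110), (325, 226, 384, 232, 105), (85, 45, 131, 217, 67),
    (37, 396, 51, 399, 178), (52, 129, 113, 272, 239), (166, 41, 269, 17, 381),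
    (289, 131, 134, 293, 199), (215, 248, 5, 2, 393), (8, 218, 325, 121, 257),
    (342, 175, 202, 99, 343), (356, 155, 334, 174, 146), (306, 346, 93, 294, 260),
    (173, 108, 150, 103, 135), (251, 242, 368, 46, 171), (339, 13, 140, 122, 367),
    (78, 74, 54, 343, 224), (54, 71, 225, 280, 250), (48, 421, 168, 422, 109),
    (336, 127, 95, 400, 406), (19, 58, 366, 255, 327), (371, 123, 211, 23, 287),
    (431, 152, 163, 430, 133), (139, 272, 347, 307, 357), (124, 412, 66, 90, 351),
    (335, 7, 190, 192, 22), (271, 1, 389, 96, 172), (164, 305, 23, 29, 66),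
    (303, 278, 110, 380, 40), (356, 248, 237, 354, 416), (385, 89, 383, 386, 95),
    (85, 358, 369, 352, 63), (59, 201, 29, 268, 382), (438, 177, 79, 214, 249),
    (366, 126, 82, 70, 12), (203, 305, 148, 329, 25), (312, 206, 296, 38, 138),
    (351, 277, 156, 47, 344), (35, 99, 285, 68, 26), (207, 399, 116, 311, 276),
    (188, 267, 405, 384, 295), (134, 294, 416, 278, 180), (377, 27, 16, 304, 353),
    (153, 156, 143, 151, 125), (266, 9, 87, 427, 251), (395, 4, 47, 422, 206),
    (190, 386, 230, 269, 338), (68, 400, 289, 263, 129), (194, 101, 29, 405, 297),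
    (31, 94, 362, 50, 217), (118, 25, 377, 379, 142), (376, 240, 386, 433, 357),
    (214, 172, 330, 329, 14), (311, 381, 220, 84, 55), (117, 13, 44, 87, 6),
    (88, 57, 398, 100, 5), (244, 51, 67, 236, 189), (56, 257, 38, 185, 333), (5, 61, 165, 8, 291),
    (262, 132, 295, 409, 202)]
    [(76, 20)] (by decide +kernel)

theorem case_454 :
    ∃ D : DirectedDesign (Fin 454) 2 4 2, D.SuperSimple ∧ D.DefiningHalf :=
  main_cert (v := 454)
    [(158, 338, 420, 431, 176), (242, 442, 36, 11, 425), (204, 317, 34, 138, 331),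
    (94, 304, 124, 206, 442), (382, 287, 395, 405, 237), (194, 157, 347, 277, 198),
    (245, 10, 84, 384, 379), (386, 79, 146, 328, 140), (188, 428, 268, 15, 433),
    (258, 410, 54, 336, 405), (75, 207, 232, 427, 404), (61, 192, 81, 278, 201),
    (383, 436, 33, 202, 11), (410, 6, 337, 269, 47), (4, 225, 302, 224, 238),
    (324, 440, 103, 272, 411), (335, 281, 193, 123, 279), (190, 338, 11, 230, 220),
    (374, 352, 307, 2, 248), (158, 427, 432, 24, 251), (319, 321, 378, 136, 316),
    (159, 451, 153, 166, 145), (6, 255, 292, 294, 349), (351, 186, 178, 51, 252),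
    (344, 437, 329, 33, 369), (354, 191, 47, 288, 291), (312, 224, 159, 138, 453),
    (279, 419, 332, 190, 327), (330, 163, 135, 218, 289), (409, 359, 33, 363, 10),
    (84, 303, 416, 402, 98), (357, 150, 388, 333, 90), (426, 352, 20, 347, 128),
    (239, 349, 179, 1, 96), (285, 254, 208, 86, 52), (237, 228, 198, 151, 193),
    (256, 407, 54, 238, 113), (223, 297, 385, 286, 326), (321, 40, 144, 262, 225),
    (320, 55, 300, 91, 416), (348, 96, 39, 438, 197), (39, 82, 282, 228, 143),
    (164, 47, 348, 62, 2), (299, 210, 36, 183, 413), (356, 278, 308, 271, 280),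
    (240, 114, 262, 367, 316), (437, 395, 421, 56, 300), (32, 58, 253, 435, 258),
    (165, 255, 226, 270, 377), (118, 306, 99, 164, 287), (141, 413, 42, 248, 408),
    (345, 279, 244, 394, 283), (362, 385, 324, 284, 367), (325, 272, 91, 453, 148),
    (310, 429, 375, 275, 447), (65, 451, 73, 325, 159), (132, 11, 339, 422, 437),
    (136, 93, 73, 189, 191), (340, 169, 445, 420, 425), (81, 299, 94, 284, 152),
    (86, 309, 308, 99, 196), (121, 21, 28, 423, 31), (115, 283, 270, 384, 131),
    (362, 304, 319, 337, 346), (213, 418, 146, 104, 398), (268, 57, 218, 300, 276),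
    (334, 276, 398, 435, 203), (89, 412, 293, 52, 163), (72, 413, 167, 181, 386),
    (197, 297, 235, 21, 391), (64, 133, 305, 257, 83), (267, 24, 397, 342, 293),
    (427, 88, 227, 409, 97), (239, 67, 60, 229, 251), (334, 270, 305, 442, 446)]
    [(195, 384)] (by decide +kernel)

theorem case_457 :
    ∃ D : DirectedDesign (Fin 457) 2 4 2, D.SuperSimple ∧ D.DefiningHalf :=
  main_cert (v := 457)
    [(21, 433, 30, 380, 151), (22, 309, 104, 116, 111), (29, 265, 81, 326, 149),
    (456, 30, 382, 89, 179), (118, 151, 24, 325, 26), (289, 323, 408, 293, 392),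
    (64, 134, 46, 321, 160), (257, 391, 10, 171, 341), (419, 128, 151, 361, 388),
    (373, 317, 89, 444, 414), (12, 378, 193, 25, 32), (64, 289, 113, 211, 14),
    (353, 83, 390, 133, 55), (65, 348, 23, 113, 295), (117, 426, 128, 255, 258),
    (73, 276, 269, 397, 350), (123, 106, 254, 137, 54), (217, 341, 105, 275, 401),
    (422, 349, 315, 15, 265), (296, 96, 47, 194, 5), (348, 68, 40, 165, 19),
    (258, 388, 93, 389, 164), (147, 418, 409, 439, 421), (285, 326, 325, 206, 307),
    (303, 111, 206, 222, 391), (144, 338, 37, 62, 3), (219, 207, 447, 60, 253),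
    (357, 177, 321, 99, 187), (303, 32, 140, 248, 8), (256, 204, 434, 386, 75),
    (347, 410, 420, 63, 331), (127, 147, 365, 395, 283), (438, 428, 34, 95, 60),
    (201, 165, 14, 429, 396), (381, 385, 324, 53, 319), (213, 376, 380, 350, 341),
    (155, 172, 284, 16, 371), (118, 190, 333, 378, 66), (57, 406, 291, 193, 454),
    (158, 185, 381, 343, 337), (220, 267, 129, 330, 181), (300, 285, 150, 77, 197),
    (379, 420, 148, 2, 320), (351, 206, 343, 159, 271), (242, 219, 97, 404, 366),
    (44, 332, 247, 296, 139), (87, 113, 197, 391, 209), (152, 359, 51, 315, 183),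
    (282, 328, 360, 372, 273), (115, 143, 386, 25, 442), (146, 401, 355, 11, 13),
    (58, 214, 305, 126, 440), (315, 139, 33, 319, 455), (221, 446, 176, 33, 224),
    (226, 21, 121, 419, 215), (212, 57, 77, 305, 164), (241, 414, 239, 449, 235),
    (263, 180, 202, 196, 52), (244, 42, 413, 70, 120), (51, 80, 416, 6, 177),
    (334, 45, 99, 279, 401), (103, 314, 71, 28, 259), (218, 191, 230, 343, 451),
    (70, 1, 357, 27, 444), (111, 49, 25, 443, 363), (188, 290, 364, 209, 421),
    (198, 246, 24, 63, 439), (385, 195, 179, 290, 431), (171, 450, 259, 396, 26),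
    (119, 163, 89, 223, 158), (42, 164, 279, 224, 390), (398, 414, 245, 273, 452),
    (117, 35, 407, 364, 204), (359, 304, 7, 262, 267), (208, 140, 155, 438, 134),
    (336, 361, 344, 82, 356)]
    [] (by decide +kernel)

theorem case_460 :
    ∃ D : DirectedDesign (Fin 460) 2 4 2, D.SuperSimple ∧ D.DefiningHalf :=
  main_cert (v := 460)
    [(204, 322, 88, 222, 356), (320, 119, 400, 315, 120), (35, 435, 425, 390, 141),
    (352, 324, 176, 442, 169), (55, 171, 377, 398, 15), (338, 87, 251, 184, 6),
    (292, 392, 267, 263, 16), (84, 283, 304, 387, 179), (266, 185, 159, 169, 175),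
    (402, 307, 53, 403, 235), (71, 355, 96, 311, 370), (45, 310, 24, 421, 29),
    (111, 357, 257, 330, 32), (426, 372, 33, 410, 88), (306, 364, 413, 340, 33),
    (384, 104, 290, 359, 323), (236, 299, 188, 357, 186), (348, 12, 380, 48, 334),
    (68, 156, 305, 165, 260), (132, 401, 142, 11, 414), (109, 169, 142, 312, 270),
    (159, 128, 108, 456, 445), (56, 123, 289, 44, 137), (191, 420, 255, 432, 439),
    (147, 155, 261, 230, 96), (262, 343, 234, 73, 21), (329, 360, 203, 94, 226),
    (303, 302, 383, 7, 82), (202, 300, 171, 173, 106), (113, 437, 399, 442, 252),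
    (272, 441, 408, 449, 24), (99, 444, 414, 258, 418), (86, 250, 259, 391, 327),
    (30, 49, 43, 312, 10), (65, 231, 193, 17, 182), (231, 226, 391, 297, 437),
    (350, 146, 27, 72, 253), (358, 194, 120, 147, 61), (65, 418, 421, 59, 308),
    (371, 368, 83, 335, 244), (15, 452, 350, 360, 29), (205, 346, 419, 146, 207),
    (414, 77, 182, 228, 172), (150, 275, 22, 280, 78), (227, 10, 109, 434, 451),
    (359, 94, 51, 22, 2), (268, 23, 232, 189, 135), (134, 419, 277, 47, 432),
    (370, 407, 54, 3, 248), (346, 417, 275, 271, 222), (264, 448, 227, 413, 362),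
    (293, 279, 43, 276, 143), (333, 320, 386, 129, 422), (267, 327, 329, 80, 17),
    (85, 270, 325, 84, 237), (37, 89, 317, 299, 99), (316, 252, 390, 324, 247),
    (126, 397, 47, 288, 456), (13, 208, 264, 137, 419), (345, 421, 179, 200, 343),
    (246, 30, 385, 9, 50), (45, 36, 456, 290, 354), (91, 314, 352, 218, 242),
    (78, 294, 74, 154, 403), (217, 311, 394, 358, 235), (113, 205, 118, 69, 198),
    (441, 309, 297, 440, 285), (344, 31, 436, 153, 5), (388, 173, 176, 58, 302),
    (221, 403, 82, 173, 446), (119, 40, 407, 186, 281), (434, 44, 254, 426, 382),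
    (433, 203, 315, 170, 97), (22, 192, 199, 397, 120), (263, 302, 453, 325, 367),
    (82, 348, 359, 238, 50)]
    [(181, 247)] (by decide +kernel)

theorem case_463 :
    ∃ D : DirectedDesign (Fin 463) 2 4 2, D.SuperSimple ∧ D.DefiningHalf :=
  main_cert (v := 463)
    [(28, 88, 85, 241, 219), (79, 298, 31, 392, 456), (163, 309, 76, 2, 377),
    (297, 435, 239, 452, 195), (371, 412, 322, 352, 69), (446, 428, 217, 264, 59),
    (5, 131, 188, 95, 451), (305, 455, 351, 91, 65), (162, 386, 40, 279, 270),
    (372, 246, 445, 181, 228), (125, 145, 167, 101, 373), (450, 76, 84, 53, 182),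
    (43, 321, 260, 235, 173), (327, 228, 391, 200, 424), (189, 247, 233, 1, 74),
    (277, 304, 101, 222, 262), (226, 399, 264, 368, 245), (271, 208, 250, 253, 221),
    (323, 298, 263, 288, 437), (393, 225, 353, 211, 66), (227, 320, 235, 6, 391),
    (351, 358, 97, 57, 98), (83, 197, 229, 434, 38), (82, 261, 383, 316, 412),
    (243, 198, 123, 354, 209), (389, 105, 1, 428, 230), (212, 18, 232, 250, 72),
    (187, 426, 87, 185, 385), (308, 151, 152, 410, 439), (335, 202, 256, 410, 52),
    (295, 123, 276, 252, 326), (9, 331, 245, 146, 24), (132, 238, 36, 76, 86),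
    (4, 156, 407, 160, 27), (294, 171, 141, 87, 272), (241, 190, 62, 125, 312),
    (209, 19, 184, 24, 219), (287, 369, 267, 149, 435), (356, 390, 148, 319, 179),
    (148, 90, 93, 267, 53), (113, 180, 134, 33, 117), (167, 328, 246, 204, 157),
    (94, 142, 16, 260, 111), (48, 110, 419, 144, 298), (170, 461, 324, 29, 259),
    (345, 194, 101, 88, 388), (248, 194, 347, 8, 1), (386, 447, 121, 105, 7),
    (120, 223, 52, 50, 449), (39, 393, 243, 437, 232), (33, 205, 125, 318, 304),
    (357, 448, 50, 152, 294), (100, 37, 316, 252, 146), (303, 452, 429, 207, 290),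
    (129, 87, 262, 365, 21), (354, 398, 423, 138, 116), (395, 212, 31, 332, 301),
    (71, 210, 30, 221, 57), (407, 110, 114, 404, 303), (320, 186, 329, 375, 32),
    (457, 304, 319, 44, 397), (414, 23, 452, 282, 363), (255, 458, 108, 328, 452),
    (103, 61, 218, 411, 436), (345, 248, 333, 386, 374), (418, 245, 232, 237, 113),
    (30, 404, 289, 129, 336), (342, 168, 275, 238, 54), (447, 427, 344, 161, 194),
    (324, 193, 382, 409, 226), (427, 257, 164, 316, 232), (262, 264, 342, 257, 289),
    (273, 122, 296, 3, 397), (416, 12, 176, 395, 67), (382, 102, 274, 327, 333),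
    (292, 177, 411, 26, 95), (178, 117, 453, 305, 62)]
    [] (by decide +kernel)

theorem case_478 :
    ∃ D : DirectedDesign (Fin 478) 2 4 2, D.SuperSimple ∧ D.DefiningHalf :=
  main_cert (v := 478)
    [(231, 164, 470, 272, 220), (76, 159, 423, 313, 377), (151, 86, 80, 316, 244),
    (203, 51, 295, 256, 407), (143, 375, 322, 221, 334), (192, 465, 265, 330, 288),
    (315, 412, 446, 199, 390), (228, 266, 399, 192, 215), (202, 186, 328, 469, 359),
    (389, 411, 138, 380, 175), (207, 161, 167, 31, 385), (118, 380, 427, 140, 461),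
    (77, 372, 181, 448, 165), (16, 165, 189, 48, 226), (172, 442, 71, 106, 215),
    (173, 383, 128, 321, 384), (46, 85, 36, 204, 91), (471, 356, 245, 409, 304),
    (185, 147, 449, 174, 318), (162, 187, 172, 95, 389), (471, 465, 124, 227, 269),
    (404, 31, 66, 281, 94), (21, 371, 59, 239, 450), (260, 124, 458, 259, 434),
    (248, 55, 213, 170, 146), (294, 309, 24, 116, 353), (262, 224, 320, 56, 137),
    (312, 87, 79, 284, 261), (91, 15, 77, 308, 356), (271, 416, 3, 328, 92),
    (241, 375, 445, 126, 466), (129, 52, 466, 72, 263), (54, 164, 476, 9, 426),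
    (86, 13, 366, 97, 116), (428, 87, 319, 28, 197), (346, 236, 345, 435, 286),
    (357, 212, 228, 476, 330), (243, 90, 431, 375, 425), (114, 403, 249, 345, 376),
    (298, 56, 283, 417, 378), (398, 256, 315, 28, 17), (155, 293, 55, 439, 245),
    (180, 437, 397, 438, 446), (84, 288, 342, 297, 293), (325, 307, 255, 411, 44),
    (23, 41, 418, 441, 406), (219, 40, 374, 37, 173), (44, 475, 26, 386, 474),
    (140, 308, 120, 477, 26), (188, 316, 68, 94, 127), (459, 201, 292, 111, 377),
    (278, 229, 412, 3, 292), (160, 314, 150, 64, 414), (337, 158, 58, 400, 406),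
    (161, 57, 100, 159, 9), (123, 104, 300, 358, 55), (365, 407, 82, 74, 88),
    (5, 261, 358, 31, 1), (34, 127, 203, 82, 443), (168, 56, 103, 148, 22),
    (339, 347, 45, 196, 36), (285, 235, 391, 62, 236), (405, 90, 22, 352, 171),
    (348, 221, 116, 134, 139), (79, 111, 221, 149, 122), (282, 183, 302, 339, 279),
    (201, 189, 108, 206, 461), (37, 391, 461, 366, 58), (296, 292, 267, 403, 151),
    (98, 254, 386, 68, 167), (415, 187, 268, 114, 457), (152, 269, 29, 360, 270),
    (115, 272, 394, 224, 395), (393, 335, 105, 96, 379), (33, 376, 317, 278, 437),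
    (331, 396, 357, 85, 51), (25, 222, 240, 357, 202), (324, 336, 84, 351, 2),
    (249, 379, 454, 468, 366)]
    [(370, 225)] (by decide +kernel)

theorem case_481 :
    ∃ D : DirectedDesign (Fin 481) 2 4 2, D.SuperSimple ∧ D.DefiningHalf :=
  main_cert (v := 481)
    [(460, 440, 438, 344, 289), (243, 136, 132, 418, 253), (39, 272, 475, 395, 96),
    (303, 255, 96, 359, 203), (285, 27, 68, 319, 173), (99, 5, 414, 152, 206),
    (400, 418, 323, 474, 63), (321, 257, 177, 379, 471), (154, 276, 226, 29, 214),
    (296, 78, 173, 103, 347), (105, 51, 88, 235, 448), (101, 288, 76, 295, 179),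
    (326, 163, 359, 154, 78), (265, 103, 9, 4, 377), (187, 60, 131, 89, 202),
    (211, 107, 127, 76, 456), (9, 58, 457, 310, 252), (69, 245, 311, 282, 153),
    (48, 189, 441, 301, 462), (391, 299, 141, 28, 308), (227, 429, 38, 73, 351),
    (35, 283, 8, 409, 276), (114, 168, 179, 392, 266), (88, 295, 400, 61, 425),
    (230, 309, 283, 148, 241), (160, 272, 381, 184, 225), (341, 478, 222, 247, 111),
    (284, 422, 145, 161, 402), (68, 36, 192, 66, 276), (420, 15, 463, 263, 396),
    (226, 77, 120, 83, 38), (181, 394, 289, 443, 68), (80, 372, 195, 455, 38),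
    (161, 236, 382, 275, 238), (214, 69, 289, 287, 221), (445, 342, 463, 306, 384),
    (419, 282, 449, 228, 435), (127, 17, 162, 396, 173), (59, 385, 13, 414, 195),
    (165, 19, 153, 131, 322), (91, 377, 143, 110, 449), (479, 310, 165, 28, 225),
    (71, 437, 45, 40, 188), (235, 140, 115, 240, 254), (91, 155, 12, 247, 279),
    (70, 74, 472, 431, 309), (150, 12, 142, 291, 151), (263, 59, 350, 437, 257),
    (42, 208, 73, 93, 242), (249, 52, 271, 377, 97), (201, 432, 188, 395, 335),
    (53, 275, 211, 478, 100), (460, 118, 95, 332, 151), (37, 57, 117, 199, 407),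
    (132, 251, 215, 135, 138), (175, 392, 100, 183, 222), (419, 1, 217, 75, 174),
    (464, 379, 48, 176, 191), (303, 313, 22, 435, 35), (184, 301, 294, 455, 363),
    (159, 129, 253, 458, 112), (119, 467, 250, 74, 248), (252, 394, 111, 246, 415),
    (183, 360, 58, 54, 465), (13, 164, 429, 166, 190), (384, 395, 153, 355, 288),
    (383, 260, 311, 113, 426), (212, 296, 410, 224, 394), (399, 176, 184, 31, 167),
    (261, 353, 338, 98, 432), (437, 40, 29, 41, 142), (16, 391, 186, 125, 102),
    (447, 23, 247, 467, 130), (50, 158, 183, 49, 10), (277, 110, 157, 121, 149),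
    (317, 324, 209, 287, 55), (147, 452, 480, 477, 281), (93, 450, 259, 426, 300),
    (476, 169, 147, 267, 210), (244, 365, 467, 313, 286)]
    [] (by decide +kernel)

theorem case_496 :
    ∃ D : DirectedDesign (Fin 496) 2 4 2, D.SuperSimple ∧ D.DefiningHalf :=
  main_cert (v := 496)
    [(131, 314, 157, 276, 401), (266, 424, 137, 472, 38), (253, 287, 468, 186, 91),
    (152, 474, 298, 273, 217), (433, 419, 198, 215, 248), (286, 433, 260, 477, 118),
    (238, 479, 318, 335, 145), (57, 390, 394, 9, 285), (242, 412, 208, 262, 388),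
    (84, 364, 397, 460, 11), (252, 61, 283, 12, 234), (86, 424, 49, 313, 490),
    (288, 328, 428, 184, 491), (171, 358, 29, 46, 295), (442, 483, 494, 211, 321),
    (195, 16, 166, 108, 111), (489, 472, 379, 257, 393), (450, 70, 380, 153, 53),
    (35, 250, 240, 268, 298), (184, 314, 403, 119, 331), (24, 459, 99, 447, 222),
    (45, 470, 375, 432, 58), (23, 441, 359, 280, 147), (81, 42, 174, 433, 310),
    (482, 374, 471, 316, 269), (324, 334, 127, 476, 133), (55, 439, 234, 419, 122),
    (151, 446, 68, 329, 181), (464, 64, 404, 195, 194), (21, 367, 28, 431, 331),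
    (271, 21, 90, 445, 6), (420, 3, 267, 260, 81), (164, 8, 60, 239, 407),
    (15, 17, 133, 402, 455), (44, 154, 434, 117, 399), (140, 117, 1, 266, 289),
    (465, 421, 369, 415, 49), (285, 487, 220, 460, 419), (438, 411, 13, 384, 142),
    (427, 72, 461, 119, 202), (293, 307, 184, 6, 120), (345, 126, 217, 305, 286),
    (82, 475, 360, 193, 222), (251, 362, 55, 136, 474), (85, 67, 333, 252, 59),
    (346, 177, 106, 22, 353), (51, 460, 214, 205, 340), (435, 445, 395, 192, 385),
    (128, 436, 158, 90, 43), (365, 66, 468, 10, 8), (155, 492, 101, 83, 454),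
    (417, 176, 454, 491, 458), (53, 334, 13, 333, 471), (352, 384, 107, 207, 143),
    (304, 169, 8, 295, 105), (204, 247, 352, 273, 234), (358, 75, 359, 390, 132),
    (408, 112, 107, 307, 481), (160, 156, 444, 176, 149), (484, 117, 392, 291, 438),
    (434, 319, 316, 210, 238), (135, 325, 448, 437, 332), (471, 102, 108, 45, 89),
    (202, 273, 371, 200, 180), (405, 328, 432, 74, 306), (43, 264, 235, 48, 269),
    (16, 348, 171, 102, 236), (233, 143, 272, 110, 155), (19, 418, 231, 213, 337),
    (259, 383, 152, 326, 87), (279, 237, 246, 130, 377), (350, 90, 252, 89, 476),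
    (416, 188, 74, 240, 237), (282, 395, 128, 255, 449), (311, 460, 142, 66, 377),
    (76, 402, 353, 413, 59), (428, 181, 255, 314, 459), (196, 330, 400, 130, 402),
    (440, 4, 39, 348, 448), (120, 242, 355, 38, 199), (88, 203, 383, 1, 103),
    (187, 153, 326, 175, 314)]
    [(478, 206)] (by decide +kernel)

theorem case_499 :
    ∃ D : DirectedDesign (Fin 499) 2 4 2, D.SuperSimple ∧ D.DefiningHalf :=
  main_cert (v := 499)
    [(24, 323, 319, 304, 175), (16, 437, 103, 239, 72), (474, 317, 455, 477, 64),
    (133, 257, 141, 6, 250), (370, 3, 427, 19, 479), (373, 158, 133, 190, 306),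
    (272, 438, 43, 326, 451), (455, 281, 457, 242, 53), (262, 304, 97, 120, 248),
    (261, 381, 115, 15, 150), (308, 142, 249, 186, 231), (488, 17, 173, 37, 236),
    (4, 144, 304, 196, 438), (419, 196, 345, 289, 28), (30, 255, 186, 241, 117),
    (442, 362, 344, 320, 437), (187, 330, 47, 141, 486), (128, 97, 277, 70, 101),
    (417, 218, 421, 130, 340), (198, 225, 216, 317, 243), (202, 239, 45, 41, 347),
    (201, 316, 355, 365, 344), (137, 360, 208, 12, 345), (405, 168, 466, 219, 209),
    (247, 104, 84, 464, 14), (177, 289, 7, 496, 216), (394, 69, 434, 160, 2),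
    (363, 131, 34, 284, 332), (446, 12, 200, 307, 259), (41, 373, 476, 13, 268),
    (148, 433, 357, 418, 69), (38, 353, 322, 103, 287), (35, 487, 372, 42, 484),
    (346, 269, 150, 3, 361), (76, 275, 347, 317, 265), (441, 407, 190, 187, 160),
    (222, 311, 126, 147, 476), (253, 243, 400, 233, 381), (231, 230, 169, 144, 73),
    (50, 472, 386, 225, 415), (55, 206, 432, 425, 399), (354, 444, 261, 184, 60),
    (178, 46, 60, 14, 87), (56, 374, 139, 203, 91), (161, 383, 250, 135, 236),
    (414, 416, 450, 178, 447), (348, 67, 395, 111, 155), (488, 346, 267, 342, 325),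
    (477, 8, 189, 29, 397), (431, 221, 409, 220, 81), (448, 203, 15, 204, 84),
    (318, 335, 413, 364, 430), (331, 297, 68, 380, 416), (95, 113, 25, 168, 200),
    (6, 241, 251, 197, 95), (228, 176, 340, 111, 127), (172, 278, 302, 239, 480),
    (498, 6, 204, 304, 456), (406, 116, 208, 7, 186), (171, 33, 265, 107, 159),
    (38, 78, 326, 88, 83), (102, 121, 172, 260, 110), (206, 365, 70, 321, 285),
    (330, 367, 359, 270, 332), (240, 417, 470, 16, 272), (121, 160, 296, 36, 179),
    (23, 189, 479, 216, 423), (391, 378, 165, 271, 359), (96, 343, 415, 122, 388),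
    (314, 107, 327, 408, 173), (59, 393, 41, 190, 162), (192, 171, 197, 99, 489),
    (389, 21, 75, 380, 436), (418, 467, 242, 389, 125), (385, 361, 459, 267, 390),
    (205, 82, 137, 354, 413), (428, 21, 153, 305, 213), (226, 163, 325, 43, 256),
    (63, 96, 401, 498, 123), (409, 279, 175, 282, 426), (287, 433, 393, 401, 182),
    (386, 88, 285, 278, 224), (490, 100, 214, 37, 91)]
    [] (by decide +kernel)

theorem case_553 :
    ∃ D : DirectedDesign (Fin 553) 2 4 2, D.SuperSimple ∧ D.DefiningHalf :=
  main_cert (v := 553)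
    [(528, 77, 509, 23, 15), (89, 451, 414, 482, 159), (352, 256, 456, 189, 100),
    (420, 44, 539, 489, 488), (336, 152, 243, 136, 169), (187, 536, 192, 541, 234),
    (481, 100, 82, 373, 86), (479, 112, 480, 366, 176), (547, 409, 434, 57, 143),
    (403, 170, 344, 525, 469), (396, 384, 10, 50, 32), (34, 156, 283, 501, 91),
    (405, 248, 30, 25, 200), (180, 416, 76, 172, 267), (302, 151, 470, 257, 505),
    (309, 56, 407, 442, 491), (533, 118, 431, 507, 271), (212, 400, 104, 513, 392),
    (26, 12, 543, 274, 330), (356, 211, 70, 111, 59), (355, 550, 31, 483, 423),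
    (182, 445, 436, 439, 88), (204, 29, 173, 164, 343), (452, 302, 322, 72, 179),
    (69, 527, 390, 460, 8), (404, 407, 229, 273, 153), (235, 16, 466, 504, 450),
    (132, 230, 348, 38, 501), (498, 306, 110, 51, 177), (65, 547, 441, 140, 429),
    (389, 242, 221, 195, 283), (355, 524, 265, 295, 217), (328, 419, 478, 41, 10),
    (523, 435, 158, 295, 316), (241, 83, 220, 326, 188), (275, 332, 29, 142, 308),
    (51, 227, 346, 166, 351), (372, 360, 123, 199, 284), (261, 15, 408, 545, 517),
    (341, 500, 155, 63, 296), (427, 177, 298, 53, 110), (272, 468, 168, 231, 209),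
    (24, 542, 312, 466, 502), (268, 311, 1, 463, 220), (131, 206, 32, 287, 360),
    (456, 214, 537, 161, 58), (526, 277, 158, 293, 101), (370, 428, 11, 371, 522),
    (81, 255, 163, 49, 188), (219, 234, 375, 99, 500), (76, 359, 169, 550, 289),
    (473, 469, 308, 262, 466), (412, 160, 299, 313, 315), (458, 360, 290, 36, 40),
    (514, 74, 217, 38, 167), (399, 96, 523, 289, 352), (222, 178, 359, 419, 437),
    (274, 195, 72, 83, 383), (216, 60, 282, 340, 321), (511, 235, 289, 166, 543),
    (67, 480, 166, 5, 444), (394, 24, 285, 439, 269), (369, 58, 345, 411, 516),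
    (475, 50, 275, 82, 199), (4, 491, 9, 474, 364), (218, 324, 426, 225, 151),
    (205, 219, 247, 167, 60), (507, 540, 9, 181, 116), (238, 123, 437, 532, 309),
    (428, 399, 520, 214, 448), (23, 92, 362, 288, 64), (327, 140, 236, 286, 243),
    (540, 22, 337, 170, 299), (2, 473, 226, 48, 239), (171, 518, 85, 485, 64),
    (441, 197, 103, 213, 2), (382, 172, 497, 547, 321), (526, 165, 89, 34, 174),
    (290, 398, 436, 210, 344), (293, 246, 508, 163, 489), (391, 146, 291, 535, 400),
    (221, 294, 411, 357, 350), (516, 501, 405, 367, 306), (476, 421, 23, 463, 134),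
    (223, 460, 504, 347, 475), (514, 122, 136, 79, 350), (273, 430, 19, 5, 120),
    (127, 537, 43, 536, 406), (50, 7, 305, 537, 3), (333, 271, 11, 518, 224),
    (313, 448, 381, 499, 405), (536, 135, 455, 346, 11)]
    [] (by decide +kernel)

end CyclicDD

/-- For every `v` in the given set there exists a super-simple
`2-(v,4,2)` directed design in which every defining set contains at least
half of the blocks. -/
theorem exists_superSimple_DD_half_lemma21 (v : ℕ)
    (hv : v ∈ ({136, 139, 277, 280, 283, 292, 295, 298, 301, 409, 412, 415, 424, 427, 430, 433, 436, 439, 442, 445, 448, 454, 457, 460, 463, 478, 481, 496, 499, 553} : Finset ℕ)) :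
    ∃ D : DirectedDesign (Fin v) 2 4 2, D.SuperSimple ∧ D.DefiningHalf := by
  simp only [Finset.mem_insert, Finset.mem_singleton] at hv
  rcases hv with rfl | rfl | rfl | rfl | rfl | rfl | rfl | rfl | rfl | rfl |
    rfl | rfl | rfl | rfl | rfl | rfl | rfl | rfl | rfl | rfl |
    rfl | rfl | rfl | rfl | rfl | rfl | rfl | rfl | rfl | rfl
  · exact CyclicDD.case_136
  · exact CyclicDD.case_139
  · exact CyclicDD.case_277
  · exact CyclicDD.case_280
  · exact CyclicDD.case_283
  · exact CyclicDD.case_292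
  · exact CyclicDD.case_295
  · exact CyclicDD.case_298
  · exact CyclicDD.case_301
  · exact CyclicDD.case_409
  · exact CyclicDD.case_412
  · exact CyclicDD.case_415
  · exact CyclicDD.case_424
  · exact CyclicDD.case_427
  · exact CyclicDD.case_430
  · exact CyclicDD.case_433
  · exact CyclicDD.case_436
  · exact CyclicDD.case_439
  · exact CyclicDD.case_442
  · exact CyclicDD.case_445
  · exact CyclicDD.case_448
  · exact CyclicDD.case_454
  · exact CyclicDD.case_457
  · exact CyclicDD.case_460
  · exact CyclicDD.case_463
  · exact CyclicDD.case_478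
  · exact CyclicDD.case_481
  · exact CyclicDD.case_496
  · exact CyclicDD.case_499
  · exact CyclicDD.case_553
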